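/- Let q = p^r with p > 3 prime and q > 9887, and let E be an elliptic curve defined over F_q with j-invariant j(E) = 0 and with an even number of F_q-rational points. If r is even or p ≡ 1 (mod 3), then the 5-elliptic code associated to E is not 3-extendable. -/

import Mathlib

set_option linter.unusedSectionVars false

namespace NMDS

open WeierstrassCurve

variable {F : Type} [Field F] [Fintype F] [DecidableEq F]

/-- `ψ_i(X,Y)`: `Y^s` if `i = 3s` (`s ≥ 1`), `X·Y^s` if `i = 3s+2` (`s ≥ 0`),
`X²·Y^s` if `i = 3s+4` (`s ≥ 0`). -/
def psi (i : ℕ) (X Y : F) : F :=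
  if i % 3 = 0 then Y ^ (i / 3)
  else if i % 3 = 2 then X * Y ^ (i / 3)
  else X ^ 2 * Y ^ ((i - 4) / 3)

/-- The coordinate vector of `φ_k(P)`: `(1, ψ₂(P), …, ψ_k(P))` for an affine point `P`,
and `(0, …, 0, 1)` for the point at infinity. -/
def phiVec (W : WeierstrassCurve F) (k : ℕ) : W.toAffine.Point → (Fin k → F)
  | .zero => fun j => if (j : ℕ) = k - 1 then 1 else 0
  | .some (x := x) (y := y) _ => fun j => if (j : ℕ) = 0 then 1 else psi ((j : ℕ) + 1) x y

lemma phiVec_ne_zero (W : WeierstrassCurve F) {k : ℕ} (hk : 0 < k)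
    (P : W.toAffine.Point) : phiVec W k P ≠ 0 := by
  cases P with
  | zero =>
    intro h
    have := congrFun h ⟨k - 1, by omega⟩
    simp [phiVec] at this
  | some h' =>
    intro h
    have := congrFun h ⟨0, hk⟩
    simp [phiVec] at this

/-- The image of a rational point of `E` in `P^{k-1}(F_q)` under `φ_k`. -/
noncomputable def phiProj (W : WeierstrassCurve F) {k : ℕ} (hk : 0 < k)
    (P : W.toAffine.Point) : Projectivization F (Fin k → F) :=
  Projectivization.mk F (phiVec W k P) (phiVec_ne_zero W hk P)

/-- The `k`-elliptic code associated to `E`, relative to an enumeration `e` of the `n`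
rational points of `E`: the span of the rows of the `k × n` matrix whose `j`-th column
is `φ_k(P_j)`. -/
def ellipticCode (W : WeierstrassCurve F) (k : ℕ) {n : ℕ}
    (e : Fin n ≃ W.toAffine.Point) : Submodule F (Fin n → F) :=
  Submodule.span F (Set.range fun i : Fin k => fun j : Fin n => phiVec W k (e j) i)

/-- The minimum distance (= minimum weight) of a linear code. -/
noncomputable def minDist {n : ℕ} (C : Submodule F (Fin n → F)) : ℕ :=
  sInf {d | ∃ x ∈ C, x ≠ 0 ∧ hammingNorm x = d}

/-- The standard inner product with `y` as a linear map. -/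
def dotLin {n : ℕ} (y : Fin n → F) : (Fin n → F) →ₗ[F] F where
  toFun x := ∑ i, x i * y i
  map_add' a b := by simp [add_mul, Finset.sum_add_distrib]
  map_smul' c a := by simp [Finset.mul_sum, mul_assoc]

/-- The dual code: all vectors orthogonal to every codeword. -/
def dualCode {n : ℕ} (C : Submodule F (Fin n → F)) : Submodule F (Fin n → F) :=
  ⨅ y ∈ C, LinearMap.ker (dotLin y)

/-- The Singleton defect `s(C) = n - k + 1 - d` of a code of length `n`. -/
noncomputable def singletonDefect {n : ℕ} (C : Submodule F (Fin n → F)) : ℤ :=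
  (n : ℤ) + 1 - Module.finrank F C - minDist C

/-- A code is MDS if its Singleton defect is zero. -/
noncomputable def IsMDS {n : ℕ} (C : Submodule F (Fin n → F)) : Prop :=
  singletonDefect C = 0

/-- A code is near-MDS if both it and its dual have Singleton defect one. -/
noncomputable def IsNMDS {n : ℕ} (C : Submodule F (Fin n → F)) : Prop :=
  singletonDefect C = 1 ∧ singletonDefect (dualCode C) = 1

/-- An `[n,k,d]_q` code `C` is `h`-extendable if there is an `[n+h,k,d+h]_q` code `C'`
whose projection on the first `n` coordinates is `C`. -/
noncomputable def IsHExtendable {n : ℕ} (h : ℕ) (C : Submodule F (Fin n → F)) : Prop :=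
  ∃ C' : Submodule F (Fin (n + h) → F),
    Module.finrank F C' = Module.finrank F C ∧
    minDist C' = minDist C + h ∧
    Submodule.map (LinearMap.funLeft F F (Fin.castAdd h)) C' = C

/-- The point `p` of `P^{k-1}(F_q)` lies on the hyperplane with coefficient vector `a`. -/
def OnHyp {k : ℕ} (a : Fin k → F) (p : Projectivization F (Fin k → F)) : Prop :=
  ∑ i, a i * p.rep i = 0

/-- An `(·; k, k-2)`-set in `P^{k-1}(F_q)`: no `k+1` of its points lie on a common hyperplane,
i.e. every hyperplane contains at most `k` of its points. -/
def IsArcSet (k : ℕ) (S : Set (Projectivization F (Fin k → F))) : Prop :=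
  ∀ a : Fin k → F, a ≠ 0 → Set.ncard {p ∈ S | OnHyp a p} ≤ k

/-- A complete `(·; k, k-2)`-set: maximal with respect to set-theoretical inclusion. -/
def IsCompleteArcSet (k : ℕ) (S : Set (Projectivization F (Fin k → F))) : Prop :=
  IsArcSet k S ∧ ∀ T, IsArcSet k T → S ⊆ T → T = S

/-- Evaluation of the homogeneous cubic of a Weierstrass curve:
`Y²Z + a₁XYZ + a₃YZ² - X³ - a₂X²Z - a₄XZ² - a₆Z³`. -/
def cubicEval {R : Type*} [CommRing R] (W : WeierstrassCurve R) (x y z : R) : R :=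
  y ^ 2 * z + W.a₁ * x * y * z + W.a₃ * y * z ^ 2
    - (x ^ 3 + W.a₂ * x ^ 2 * z + W.a₄ * x * z ^ 2 + W.a₆ * z ^ 3)

/-- The gradient of the homogeneous cubic of a Weierstrass curve. -/
def gradEval {R : Type*} [CommRing R] (W : WeierstrassCurve R) (x y z : R) : Fin 3 → R :=
  ![W.a₁ * y * z - (3 * x ^ 2 + 2 * W.a₂ * x * z + W.a₄ * z ^ 2),
    2 * y * z + W.a₁ * x * z + W.a₃ * z ^ 2,
    y ^ 2 + W.a₁ * x * y + 2 * W.a₃ * y * z - (W.a₂ * x ^ 2 + 2 * W.a₄ * x * z + 3 * W.a₆ * z ^ 2)]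

/-- The point `p` of `P²(F_q)` lies on the plane cubic `E`. -/
def OnCurve (W : WeierstrassCurve F) (p : Projectivization F (Fin 3 → F)) : Prop :=
  cubicEval W (p.rep 0) (p.rep 1) (p.rep 2) = 0

/-- A line of `P²(F_q)`, given by its coefficient vector `l`, is a tangent of `E`:
it touches the curve at some point (over the algebraic closure) with multiplicity at
least two, i.e. it is the tangent line of the cubic at a contact point. -/
def IsTangentLine (W : WeierstrassCurve F) (l : Fin 3 → F) : Prop :=
  ∃ v : Fin 3 → AlgebraicClosure F, v ≠ 0 ∧
    cubicEval (W.baseChange (AlgebraicClosure F)) (v 0) (v 1) (v 2) = 0 ∧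
    (∑ i, algebraMap F (AlgebraicClosure F) (l i) * v i) = 0 ∧
    ∃ t : AlgebraicClosure F, t ≠ 0 ∧
      gradEval (W.baseChange (AlgebraicClosure F)) (v 0) (v 1) (v 2) =
        t • fun i => algebraMap F (AlgebraicClosure F) (l i)

/-- A line of `P²(F_q)` intersects `E` in three distinct `F_q`-rational points. -/
def IsThreeSecant (W : WeierstrassCurve F) (l : Fin 3 → F) : Prop :=
  ∃ u v w : Projectivization F (Fin 3 → F), u ≠ v ∧ u ≠ w ∧ v ≠ w ∧
    OnCurve W u ∧ OnCurve W v ∧ OnCurve W w ∧ OnHyp l u ∧ OnHyp l v ∧ OnHyp l w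

section

open Polynomial

theorem exists_hasseDeriv_pow_eq (G : F[X]) (n k : ℕ) :
    ∃ E : F[X], E.natDegree ≤ k * G.natDegree ∧
      G ^ k * hasseDeriv k (G ^ n) = G ^ n * E := by
  induction n generalizing k with
  | zero =>
    rcases Nat.eq_zero_or_pos k with rfl | hk
    · exact ⟨1, by simp, by simp⟩
    · exact ⟨0, by simp, by simp [hasseDeriv_apply_one k hk]⟩
  | succ n ih =>
    choose E hdeg hE using ih
    let A : ℕ → F[X] := fun i => if i = 0 then 1 else G ^ (i - 1) * hasseDeriv i G
    have hA : ∀ i, G ^ i * hasseDeriv i G = G * A i := by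
      intro i
      rcases i with _ | i
      · simp [A]
      · simp [A, pow_succ]; ring
    have hAdeg : ∀ i, (A i).natDegree ≤ i * G.natDegree := by
      intro i
      rcases i with _ | i
      · simp [A]
      · simp only [A, Nat.succ_ne_zero, if_false, Nat.add_sub_cancel]
        have h1 := natDegree_hasseDeriv_le G (i + 1)
        have h2 : (G ^ i).natDegree ≤ i * G.natDegree := natDegree_pow_le
        refine natDegree_mul_le.trans ?_
        rw [add_mul]; omega
    refine ⟨∑ x ∈ Finset.HasAntidiagonal.antidiagonal k, A x.2 * E x.1, ?_, ?_⟩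
    · refine natDegree_sum_le_of_forall_le _ _ fun x hx => ?_
      rw [Finset.HasAntidiagonal.mem_antidiagonal] at hx
      refine natDegree_mul_le.trans ?_
      have h1 := hAdeg x.2
      have h2 := hdeg x.1
      rw [← hx, add_mul]; omega
    · rw [pow_succ, hasseDeriv_mul, Finset.mul_sum, Finset.mul_sum]
      refine Finset.sum_congr rfl fun x hx => ?_
      rw [Finset.HasAntidiagonal.mem_antidiagonal] at hx
      rw [← hx, pow_add]
      linear_combination (G ^ x.2 * hasseDeriv x.2 G) * hE x.1 + G ^ n * E x.1 * hA x.2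


/-- If the polynomial `∑ (rᵢ + sᵢ G ^ g) X ^ (q i)` vanishes, all low-degree coefficients do. -/
theorem stepanov_independent {q : ℕ} (hq : Fintype.card F = q) {g L J : ℕ} (hg : 2 * g + 1 = q)
    {G : F[X]} (hG0 : G.eval 0 ≠ 0) (hGsq : ∀ (c : F) (H : F[X]), G ≠ C c * H ^ 2)
    (hL : 2 * L + G.natDegree ≤ q + 1) {r s : Fin J → F[X]}
    (hr : ∀ i, (r i).degree < L) (hs : ∀ i, (s i).degree < L)
    (h : ∑ i, (r i + s i * G ^ g) * X ^ (q * (i : ℕ)) = 0) : ∀ i, r i = 0 ∧ s i = 0 := by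
  by_contra! hne
  have hex : ∃ i, ¬ (r i = 0 ∧ s i = 0) := by
    obtain ⟨i, hi⟩ := hne; exact ⟨i, by tauto⟩
  classical
  obtain ⟨i, hi, hmin⟩ : ∃ i, ¬ (r i = 0 ∧ s i = 0) ∧ ∀ j < i, r j = 0 ∧ s j = 0 := by
    obtain ⟨i, hi⟩ := exists_minimal_of_wellFoundedLT _ hex
    refine ⟨i, hi.1, fun j hj => ?_⟩
    by_contra hc
    exact absurd (hi.2 hc hj.le) (not_le.2 hj)
  have hq0 : 0 < q := hq ▸ Fintype.card_pos
  have hdvd : X ^ q ∣ r i + s i * G ^ g := by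
    have h1 : X ^ (q * (i : ℕ) + q) ∣ (r i + s i * G ^ g) * X ^ (q * (i : ℕ)) := by
      rw [← Finset.add_sum_erase _ _ (Finset.mem_univ i)] at h
      rw [eq_neg_of_add_eq_zero_left h]
      refine (dvd_neg).2 (Finset.dvd_sum fun j hj => ?_)
      rcases lt_trichotomy j i with hji | hji | hji
      · simp [hmin j hji]
      · simp [hji] at hj
      · refine Dvd.dvd.mul_left (pow_dvd_pow _ ?_) _
        have : (i : ℕ) + 1 ≤ j := hji
        calc q * (i : ℕ) + q = q * (i + 1) := by ring
          _ ≤ _ := Nat.mul_le_mul_left _ this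
    rw [pow_add, mul_comm (X ^ _)] at h1
    exact (mul_dvd_mul_iff_right (pow_ne_zero _ X_ne_zero)).1 h1
  have hGq : X ^ q ∣ G ^ q - C (G.eval 0) := by
    have h1 : X ^ q ∣ (G - C (G.eval 0)) ^ q := by
      refine pow_dvd_pow_of_dvd ?_ q
      rw [X_dvd_iff]; simp [coeff_zero_eq_eval_zero]
    obtain ⟨p, hp⟩ := CharP.exists F
    obtain ⟨n, hpp, hn⟩ := FiniteField.card F p
    have := Fact.mk hpp
    rw [← hq, hn, sub_pow_char_pow, ← hn, ← C_pow, FiniteField.pow_card] at h1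
    rw [← hq]; exact h1
  have hdvd2 : X ^ q ∣ r i ^ 2 * G - C (G.eval 0) * s i ^ 2 := by
    have e : r i ^ 2 * G - C (G.eval 0) * s i ^ 2 =
        (r i + s i * G ^ g) * ((r i - s i * G ^ g) * G) + (G ^ q - C (G.eval 0)) * s i ^ 2 := by
      rw [← hg]; ring
    rw [e]
    exact dvd_add (hdvd.mul_right _) (hGq.mul_right _)
  have hdeg : ∀ {f : F[X]}, f.degree < L → f = 0 ∨ f.natDegree + 1 ≤ L := by
    intro f hf
    by_cases h0 : f = 0
    · exact Or.inl h0
    · right; exact (natDegree_lt_iff_degree_lt h0).2 hf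
  have hzero : r i ^ 2 * G - C (G.eval 0) * s i ^ 2 = 0 := by
    refine eq_zero_of_dvd_of_natDegree_lt hdvd2 ?_
    rw [natDegree_X_pow]
    have h1 : (r i ^ 2 * G).natDegree < q := by
      rcases hdeg (hr i) with h0 | h0
      · simpa [h0] using hq0
      · have a1 : (r i ^ 2 * G).natDegree ≤ (r i ^ 2).natDegree + G.natDegree := natDegree_mul_le
        have a2 : (r i ^ 2).natDegree ≤ 2 * (r i).natDegree := natDegree_pow_le
        omega
    have h2 : (C (G.eval 0) * s i ^ 2).natDegree < q := by
      rcases hdeg (hs i) with h0 | h0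
      · simpa [h0] using hq0
      · have a1 := natDegree_C_mul_le (G.eval 0) (s i ^ 2)
        have a2 : (s i ^ 2).natDegree ≤ 2 * (s i).natDegree := natDegree_pow_le
        omega
    exact (natDegree_sub_le _ _).trans_lt (max_lt h1 h2)
  rw [sub_eq_zero] at hzero
  by_cases hr0 : r i = 0
  · refine hi ⟨hr0, ?_⟩
    simpa [hr0, hG0] using hzero.symm
  · have h1 : r i ^ 2 ∣ s i ^ 2 := by
      have : r i ^ 2 ∣ C (G.eval 0) * s i ^ 2 := ⟨G, hzero.symm⟩
      exact (IsUnit.dvd_mul_left (isUnit_C.2 (isUnit_iff_ne_zero.2 hG0))).1 this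
    obtain ⟨u, hu⟩ := (UniqueFactorizationMonoid.pow_dvd_pow_iff_dvd two_ne_zero).1 h1
    refine hGsq (G.eval 0) u ?_
    refine mul_left_cancel₀ (pow_ne_zero 2 hr0) ?_
    rw [hzero, hu]; ring

/-- The auxiliary polynomials exist because there are more unknowns than conditions. -/
theorem stepanov_exists {g L : ℕ} (hg : g ≠ 0) (hL : 7680 < 2 * L) {G : F[X]} (hG : G.natDegree ≤ 8) :
    ∃ r s : Fin 16 → F[X], (∀ i, (r i).degree < L) ∧ (∀ i, (s i).degree < L) ∧
      (¬ ∀ i, r i = 0 ∧ s i = 0) ∧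
      ∀ x : F, G.eval x ^ g = -1 → ∀ l < 30,
        (hasseDeriv l (∑ i, (r i + s i * G ^ g) * C (x ^ (i : ℕ)))).eval x = 0 := by
  have hcount : 30 * (L + 256) < 16 * L + 16 * L := by linarith
  choose E hEdeg hE using exists_hasseDeriv_pow_eq G g
  let V := (Fin 16 → degreeLT F L) × (Fin 16 → degreeLT F L)
  let T : ℕ → V →ₗ[F] F[X] := fun l => ∑ i : Fin 16, LinearMap.mulRight F (X ^ (i : ℕ)) ∘ₗ
    (LinearMap.mulLeft F (G ^ l) ∘ₗ hasseDeriv l ∘ₗ (degreeLT F L).subtype ∘ₗ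
        LinearMap.proj i ∘ₗ LinearMap.fst F _ _ -
      (∑ x ∈ Finset.HasAntidiagonal.antidiagonal l, LinearMap.mulLeft F (G ^ x.1 * E x.2) ∘ₗ
        hasseDeriv x.1) ∘ₗ (degreeLT F L).subtype ∘ₗ LinearMap.proj i ∘ₗ LinearMap.snd F _ _)
  have hT : ∀ l v, T l v = ∑ i : Fin 16, (G ^ l * hasseDeriv l (v.1 i : F[X]) -
      ∑ x ∈ Finset.HasAntidiagonal.antidiagonal l,
        G ^ x.1 * E x.2 * hasseDeriv x.1 (v.2 i : F[X])) * X ^ (i : ℕ) := by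
    intro l v
    simp only [T, LinearMap.sum_apply, LinearMap.comp_apply, LinearMap.sub_apply,
      LinearMap.mulRight_apply, LinearMap.mulLeft_apply, Submodule.subtype_apply,
      LinearMap.proj_apply]
    rfl
  let Φ : V →ₗ[F] (Fin 30 → Fin (L + 256) → F) :=
    LinearMap.pi fun l => LinearMap.pi fun k => lcoeff F k ∘ₗ T l
  have hfin : Module.finrank F (degreeLT F L) = L := by
    rw [(degreeLTEquiv F L).finrank_eq]; simp
  have : FiniteDimensional F (degreeLT F L) := Module.Finite.equiv (degreeLTEquiv F L).symm
  have hlt : Module.finrank F (Fin 30 → Fin (L + 256) → F) < Module.finrank F V := by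
    have h1 : Module.finrank F (Fin 16 → degreeLT F L) = 16 * L := by
      simp [Module.finrank_pi_fintype, hfin]
    have h2 : Module.finrank F (Fin 30 → Fin (L + 256) → F) = 30 * (L + 256) := by
      simp [Module.finrank_pi_fintype]
    have h3 : Module.finrank F V = 16 * L + 16 * L :=
      Module.finrank_prod.trans (congrArg₂ _ h1 h1)
    exact h2.trans_lt (hcount.trans_eq h3.symm)
  have hker : LinearMap.ker Φ ≠ ⊥ := LinearMap.ker_ne_bot_of_finrank_lt hlt
  obtain ⟨v, hv, hv0⟩ := (Submodule.ne_bot_iff _).1 hker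
  have hTdeg : ∀ l < 30, (T l v).natDegree < L + 256 := by
    intro l hl
    rw [hT]
    have hvd : ∀ f : degreeLT F L, (f : F[X]).natDegree ≤ L - 1 := by
      intro f
      have := mem_degreeLT.1 f.2
      by_cases h0 : (f : F[X]) = 0
      · simp [h0]
      · have := (natDegree_lt_iff_degree_lt h0).2 this
        omega
    have hG8 : ∀ k, k * G.natDegree ≤ k * 8 := fun k => Nat.mul_le_mul_left k hG
    have hGp : ∀ k, (G ^ k).natDegree ≤ k * 8 := fun k => natDegree_pow_le.trans (hG8 k)
    have hd : ∀ (k : ℕ) (f : degreeLT F L), (hasseDeriv k (f : F[X])).natDegree ≤ L - 1 :=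
      fun k f => (natDegree_hasseDeriv_le _ _).trans (by have := hvd f; omega)
    refine lt_of_le_of_lt (natDegree_sum_le_of_forall_le (n := L - 1 + l * 8 + 15) _ _
      fun i _ => ?_) (by omega)
    refine natDegree_mul_le.trans (add_le_add ?_ ?_)
    · refine (natDegree_sub_le _ _).trans (max_le ?_ ?_)
      · refine natDegree_mul_le.trans ?_
        have := hGp l; have := hd l (v.1 i); omega
      · refine natDegree_sum_le_of_forall_le _ _ fun x hx => ?_
        rw [Finset.HasAntidiagonal.mem_antidiagonal] at hx
        refine natDegree_mul_le.trans ?_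
        have h1 : (G ^ x.1 * E x.2).natDegree ≤ _ := natDegree_mul_le
        have := hGp x.1; have := hd x.1 (v.2 i); have := (hEdeg x.2).trans (hG8 x.2)
        omega
    · rw [natDegree_X_pow]; omega
  have hT0 : ∀ l < 30, T l v = 0 := by
    intro l hl
    ext k
    rw [coeff_zero]
    by_cases hk : k < L + 256
    · exact congrFun (congrFun (LinearMap.mem_ker.1 hv) ⟨l, hl⟩) ⟨k, hk⟩
    · exact coeff_eq_zero_of_natDegree_lt (by have := hTdeg l hl; omega)
  refine ⟨fun i => v.1 i, fun i => v.2 i, fun i => mem_degreeLT.1 (v.1 i).2,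
    fun i => mem_degreeLT.1 (v.2 i).2, fun h => hv0 ?_, fun x hx l hl => ?_⟩
  · ext i : 3
    · simpa using (h i).1
    · simpa using (h i).2
  · have hGx : G.eval x ≠ 0 := by
      intro h0
      rw [h0, zero_pow hg] at hx
      exact one_ne_zero (neg_eq_zero.1 hx.symm)
    have h1 : ∀ k, G.eval x ^ k * (hasseDeriv k (G ^ g)).eval x = - (E k).eval x := by
      intro k
      have := congrArg (eval x) (hE k)
      simpa [hx] using this
    have h2 := congrArg (eval x) (hT0 l hl)
    rw [hT, eval_finsetSum] at h2
    refine (mul_eq_zero.1 ?_).resolve_left (pow_ne_zero l hGx)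
    rw [eval_zero] at h2
    rw [← h2, map_sum, eval_finsetSum, Finset.mul_sum]
    refine Finset.sum_congr rfl fun i _ => ?_
    rw [mul_comm _ (C _), ← smul_eq_C_mul, map_smul, map_add, hasseDeriv_mul]
    simp only [eval_smul, eval_add, eval_finsetSum, eval_mul, eval_sub, eval_pow, eval_X,
      smul_eq_mul]
    rw [sub_mul, mul_left_comm, mul_add, Finset.mul_sum, mul_add, mul_comm (x ^ _), sub_eq_add_neg,
      mul_comm (x ^ _), ← neg_mul, ← Finset.sum_neg_distrib]
    congr 2
    refine Finset.sum_congr rfl fun y hy => ?_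
    rw [Finset.HasAntidiagonal.mem_antidiagonal] at hy
    rw [← hy, pow_add]
    linear_combination (eval x G ^ y.1 * eval x (hasseDeriv y.1 (v.2 i : F[X]))) * h1 y.2

/-- Stepanov's bound on the number of non-square values of a polynomial of degree at most `8`. -/
theorem card_pow_eq_neg_one_le_of_eval_zero_ne {g : ℕ} (hg : 2 * g + 1 = Fintype.card F)
    (hq : 9887 < Fintype.card F) {G : F[X]} (hG : G.natDegree ≤ 8)
    (hG0 : G.eval 0 ≠ 0) (hGsq : ∀ (c : F) (H : F[X]), G ≠ C c * H ^ 2) :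
    20 * (Finset.univ.filter fun x : F => G.eval x ^ g = -1).card ≤ 13 * Fintype.card F := by
  set q := Fintype.card F with hqdef
  obtain ⟨L, hL⟩ : ∃ L, 2 * L + 7 = q := ⟨g - 3, by omega⟩
  obtain ⟨r, s, hr, hs, hne, hrs⟩ := stepanov_exists (g := g) (by omega) (L := L) (by omega) hG
  set Ψ : F[X] := ∑ i, (r i + s i * G ^ g) * X ^ (q * (i : ℕ)) with hΨ
  have hΨ0 : Ψ ≠ 0 := fun h =>
    hne (stepanov_independent hqdef.symm hg hG0 hGsq (by omega) hr hs h)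
  have hdvd : ∀ x : F, G.eval x ^ g = -1 → (X - C x) ^ 30 ∣ Ψ := by
    intro x hx
    have h1 : (X - C x) ^ 30 ∣ ∑ i, (r i + s i * G ^ g) * C (x ^ (i : ℕ)) := by
      rw [X_sub_C_pow_dvd_iff, X_pow_dvd_iff]
      intro d hd
      have := hrs x hx d hd
      rwa [← taylor_coeff] at this
    have h2 : (X - C x) ^ 30 ∣ X ^ q - C x := by
      obtain ⟨p, hp⟩ := CharP.exists F
      obtain ⟨n, hpp, hn⟩ := FiniteField.card F p
      have := Fact.mk hpp
      have e : (X - C x) ^ q = X ^ q - C x := by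
        rw [hqdef, hn, sub_pow_char_pow, ← hn, ← C_pow, FiniteField.pow_card]
      rw [← e]
      exact pow_dvd_pow _ (by omega)
    have h3 : Ψ = ∑ i, (r i + s i * G ^ g) * C (x ^ (i : ℕ)) +
        ∑ i, (r i + s i * G ^ g) * ((X ^ q) ^ (i : ℕ) - C x ^ (i : ℕ)) := by
      rw [← Finset.sum_add_distrib, hΨ]
      refine Finset.sum_congr rfl fun i _ => ?_
      rw [pow_mul, C_pow]; ring
    rw [h3]
    exact dvd_add h1 (Finset.dvd_sum fun i _ =>
      ((h2.trans (sub_dvd_pow_sub_pow _ _ _)).mul_left _))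
  have hdeg : 2 * Ψ.natDegree ≤ 39 * q := by
    have hb : Ψ.natDegree ≤ L + 8 * g + 15 * q := by
      refine natDegree_sum_le_of_forall_le _ _ fun i _ => ?_
      have hlow : ∀ f : F[X], f.degree < L → f.natDegree ≤ L := fun f hf =>
        natDegree_le_of_degree_le hf.le
      refine natDegree_mul_le.trans (add_le_add ?_ ?_)
      · refine (natDegree_add_le _ _).trans (max_le ((hlow _ (hr i)).trans (by omega)) ?_)
        refine natDegree_mul_le.trans (add_le_add (hlow _ (hs i)) ?_)
        refine natDegree_pow_le.trans ?_
        rw [mul_comm]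
        exact Nat.mul_le_mul_right g hG
      · rw [natDegree_X_pow, mul_comm]
        exact Nat.mul_le_mul_right q (by omega)
    omega
  have hcard : (Finset.univ.filter fun x : F => G.eval x ^ g = -1).card * 30 ≤ Ψ.natDegree := by
    refine le_trans ?_ (card_roots' Ψ)
    rw [← smul_eq_mul, ← Finset.sum_const]
    refine le_trans (Finset.sum_le_sum (g := fun x => Ψ.roots.count x) fun x hx => ?_) ?_
    · rw [count_roots, le_rootMultiplicity_iff hΨ0]
      exact hdvd x (by simpa using hx)
    · rw [← Multiset.sum_count_eq_card (s := Finset.univ) (m := Ψ.roots) (by simp)]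
      exact Finset.sum_le_univ_sum_of_nonneg fun _ => Nat.zero_le _
  omega

theorem card_pow_eq_neg_one_le {g : ℕ} (hg : 2 * g + 1 = Fintype.card F)
    (hq : 9887 < Fintype.card F) {G : F[X]} (hG : G.natDegree ≤ 8)
    (hGsq : ∀ (c : F) (H : F[X]), G ≠ C c * H ^ 2) :
    20 * (Finset.univ.filter fun x : F => G.eval x ^ g = -1).card ≤ 13 * Fintype.card F := by
  have hG0 : G ≠ 0 := fun h => hGsq 0 0 (by simpa using h)
  obtain ⟨a, ha⟩ : ∃ a : F, G.eval a ≠ 0 := by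
    by_contra! h
    refine hG0 (eq_zero_of_natDegree_lt_card_of_eval_eq_zero G (f := id) Function.injective_id
      (fun a => h a) ?_)
    omega
  have key := card_pow_eq_neg_one_le_of_eval_zero_ne hg hq (G := G.comp (X + C a))
    (by rw [natDegree_comp]; simpa using hG) (by simpa using ha) (fun c H h => by
      refine hGsq c (H.comp (X - C a)) ?_
      have := congrArg (fun f => f.comp (X - C a)) h
      simpa [comp_assoc] using this)
  refine le_trans (Nat.mul_le_mul_left _ (Finset.card_le_card_of_injOn (fun x => x - a) ?_ ?_)) key
  · intro x hx
    simpa using hx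
  · intro x _ y _ h
    simpa using h

theorem isSquare_or_pow_eq_neg_one {g : ℕ} (hg : 2 * g + 1 = Fintype.card F) {a : F}
    (ha : a ≠ 0) : IsSquare a ∨ a ^ g = -1 := by
  have h2 : ringChar F ≠ 2 := fun h => by
    have := FiniteField.even_card_of_char_two h
    omega
  have hg' : Fintype.card F / 2 = g := by omega
  rcases FiniteField.pow_dichotomy h2 ha with h | h
  · exact Or.inl ((FiniteField.isSquare_iff h2 ha).2 h)
  · exact Or.inr (hg' ▸ h)

theorem card_eval_eq_zero_le {E : F[X]} (hE : E ≠ 0) :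
    (Finset.univ.filter fun x : F => E.eval x = 0).card ≤ E.natDegree := by
  refine le_trans ?_ ((Multiset.toFinset_card_le _).trans (card_roots' E))
  refine Finset.card_le_card fun x hx => ?_
  simpa [hE] using hx

/-- A polynomial of degree at most `8` which is not a constant times a square has many
nonzero square values. -/
theorem exists_isSquare_eval {g : ℕ} (hg : 2 * g + 1 = Fintype.card F)
    (hq : 9887 < Fintype.card F) {G E : F[X]} (hG : G.natDegree ≤ 8)
    (hGsq : ∀ (c : F) (H : F[X]), G ≠ C c * H ^ 2) (hE0 : E ≠ 0) (hE : E.natDegree ≤ 20) :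
    ∃ x, IsSquare (G.eval x) ∧ G.eval x ≠ 0 ∧ E.eval x ≠ 0 := by
  by_contra! hc
  have hG0 : G ≠ 0 := fun h => hGsq 0 0 (by simpa using h)
  have h1 := card_pow_eq_neg_one_le hg hq hG hGsq
  have h2 := card_eval_eq_zero_le (mul_ne_zero hG0 hE0)
  rw [natDegree_mul hG0 hE0] at h2
  have h3 : (Finset.univ : Finset F) ⊆ (Finset.univ.filter fun x : F => G.eval x ^ g = -1) ∪
      (Finset.univ.filter fun x : F => (G * E).eval x = 0) := by
    intro x _
    simp only [Finset.mem_union, Finset.mem_filter, Finset.mem_univ, true_and, eval_mul,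
      mul_eq_zero]
    by_cases hx : G.eval x = 0
    · exact Or.inr (Or.inl hx)
    · rcases isSquare_or_pow_eq_neg_one hg hx with h | h
      · exact Or.inr (Or.inr (hc x h hx))
      · exact Or.inl h
  have h4 := (Finset.card_le_card h3).trans (Finset.card_union_le _ _)
  rw [Finset.card_univ] at h4
  omega

/-- Two polynomials which, like their product, do not have too many non-square values
have many simultaneous square values. -/
theorem exists_isSquare_eval_pair {g : ℕ} (hg : 2 * g + 1 = Fintype.card F)
    (hq : 9887 < Fintype.card F) {A B E : F[X]} (hA0 : A ≠ 0) (hB0 : B ≠ 0) (hE0 : E ≠ 0)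
    (hA : A.natDegree ≤ 4) (hB : B.natDegree ≤ 4) (hE : E.natDegree ≤ 20)
    (hNA : 20 * (Finset.univ.filter fun x : F => A.eval x ^ g = -1).card ≤ 13 * Fintype.card F)
    (hNB : 20 * (Finset.univ.filter fun x : F => B.eval x ^ g = -1).card ≤ 13 * Fintype.card F)
    (hNAB : 20 * (Finset.univ.filter fun x : F => (A * B).eval x ^ g = -1).card ≤
      13 * Fintype.card F) :
    ∃ x, IsSquare (A.eval x) ∧ A.eval x ≠ 0 ∧ IsSquare (B.eval x) ∧ B.eval x ≠ 0 ∧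
      E.eval x ≠ 0 := by
  by_contra! hc
  have hAE : A * B * E ≠ 0 := mul_ne_zero (mul_ne_zero hA0 hB0) hE0
  have hz := card_eval_eq_zero_le hAE
  rw [natDegree_mul (mul_ne_zero hA0 hB0) hE0, natDegree_mul hA0 hB0] at hz
  have hsum : ∑ _x : F, 2 ≤ ∑ x : F, ((if A.eval x ^ g = -1 then 1 else 0) +
      (if B.eval x ^ g = -1 then 1 else 0) + (if (A * B).eval x ^ g = -1 then 1 else 0) +
      2 * (if (A * B * E).eval x = 0 then 1 else 0)) := by
    refine Finset.sum_le_sum fun x _ => ?_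
    by_cases h0 : (A * B * E).eval x = 0
    · simp [h0]
    have hAx : A.eval x ≠ 0 := fun h => h0 (by simp [h])
    have hBx : B.eval x ≠ 0 := fun h => h0 (by simp [h])
    have hEx : E.eval x ≠ 0 := fun h => h0 (by simp [h])
    have hAB : (A * B).eval x ^ g = A.eval x ^ g * B.eval x ^ g := by rw [eval_mul, mul_pow]
    have one_of : ∀ a : F, IsSquare a → a ≠ 0 → a ^ g = 1 := by
      rintro a ⟨c, rfl⟩ ha
      have hc0 : c ≠ 0 := fun h => ha (by simp [h])
      rw [← pow_two, ← pow_mul, show 2 * g = Fintype.card F - 1 by omega]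
      exact FiniteField.pow_card_sub_one_eq_one c hc0
    rcases isSquare_or_pow_eq_neg_one hg hAx with h1 | h1 <;>
      rcases isSquare_or_pow_eq_neg_one hg hBx with h2 | h2
    · exact absurd (hc x h1 hAx h2 hBx) hEx
    · have h3 : (A * B).eval x ^ g = -1 := by rw [hAB, one_of _ h1 hAx, h2, one_mul]
      rw [if_pos h2, if_pos h3]; omega
    · have h3 : (A * B).eval x ^ g = -1 := by rw [hAB, one_of _ h2 hBx, h1, mul_one]
      rw [if_pos h1, if_pos h3]; omega
    · rw [if_pos h1, if_pos h2]; omega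
  simp only [Finset.sum_add_distrib, ← Finset.mul_sum, Finset.sum_boole, Finset.sum_const,
    Finset.card_univ, smul_eq_mul, Nat.cast_id] at hsum
  omega

/-- The quartic whose value at `m` is the discriminant of the two residual intersections of
`y² = x³ + b` with the line of slope `m` through the point `(s, -t)`. -/
noncomputable def slopeQuartic (s t : F) : F[X] :=
  X ^ 4 - C (6 * s) * X ^ 2 - C (8 * t) * X - C (3 * s ^ 2)

theorem slopeQuartic_natDegree (s t : F) : (slopeQuartic s t).natDegree = 4 := by
  unfold slopeQuartic
  compute_degree!

theorem slopeQuartic_ne_zero (s t : F) : slopeQuartic s t ≠ 0 := by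
  intro h
  have := slopeQuartic_natDegree s t
  simp [h] at this

theorem slopeQuartic_squarefree (h2 : (2 : F) ≠ 0) (h3 : (3 : F) ≠ 0) {s t : F} (ht : t ≠ 0)
    (hb : t ^ 2 - s ^ 3 ≠ 0) : Squarefree (slopeQuartic s t) := by
  rintro d ⟨e, he⟩
  have h1 : d ∣ slopeQuartic s t := ⟨d * e, by rw [he]; ring⟩
  have h1' : d ∣ derivative (slopeQuartic s t) := by
    rw [he]
    simp only [derivative_mul]
    exact ⟨2 * derivative d * e + d * derivative e, by ring⟩
  have hd : derivative (slopeQuartic s t) = 4 * X ^ 3 - 12 * C s * X - 8 * C t := by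
    simp only [slopeQuartic, derivative_sub, derivative_X_pow, derivative_C_mul, derivative_C,
      derivative_X]
    simp only [map_mul, map_ofNat, Nat.cast_ofNat]
    ring
  have key : C (384 * t * (t ^ 2 - s ^ 3)) =
      (4 * X ^ 2 - 12 * C s) * (4 * C s * X - 8 * C t) * slopeQuartic s t +
      ((4 * X ^ 2 - 12 * C s) * (2 * C t * X - C s * X ^ 2 + 3 * C s ^ 2) -
        48 * (C t ^ 2 - C s ^ 3)) * derivative (slopeQuartic s t) := by
    rw [hd, slopeQuartic]
    simp only [map_mul, map_sub, map_pow, map_ofNat]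
    ring
  have h4 : d ∣ C (384 * t * (t ^ 2 - s ^ 3)) := by
    rw [key]
    exact dvd_add (h1.mul_left _) (h1'.mul_left _)
  refine isUnit_of_dvd_unit h4 (isUnit_C.2 (isUnit_iff_ne_zero.2 ?_))
  have h384 : (384 : F) = 2 ^ 7 * 3 := by norm_num
  rw [h384]
  exact mul_ne_zero (mul_ne_zero (mul_ne_zero (pow_ne_zero _ h2) h3) ht) hb

theorem slopeQuartic_ne_C_mul_sq (h2 : (2 : F) ≠ 0) (h3 : (3 : F) ≠ 0) {s t : F} (ht : t ≠ 0)
    (hb : t ^ 2 - s ^ 3 ≠ 0) (c : F) (H : F[X]) : slopeQuartic s t ≠ C c * H ^ 2 := by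
  intro h
  have hu : IsUnit H := slopeQuartic_squarefree h2 h3 ht hb H ⟨C c, by rw [h]; ring⟩
  have h1 : (slopeQuartic s t).natDegree ≤ 0 := by
    rw [h]
    refine (natDegree_C_mul_le _ _).trans (natDegree_pow_le.trans ?_)
    simp [natDegree_eq_zero_of_isUnit hu]
  rw [slopeQuartic_natDegree] at h1
  omega

/-- The transform of `slopeQuartic` by the involution `m ↦ (A₁ m - A₂) / (A₀ m - A₁)`. -/
noncomputable def slopeQuarticTransform (s t A₀ A₁ A₂ : F) : F[X] :=
  (C A₁ * X - C A₂) ^ 4 - C (6 * s) * (C A₁ * X - C A₂) ^ 2 * (C A₀ * X - C A₁) ^ 2 -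
    C (8 * t) * (C A₁ * X - C A₂) * (C A₀ * X - C A₁) ^ 3 - C (3 * s ^ 2) * (C A₀ * X - C A₁) ^ 4

theorem slopeQuarticTransform_natDegree_le (s t A₀ A₁ A₂ : F) :
    (slopeQuarticTransform s t A₀ A₁ A₂).natDegree ≤ 4 := by
  unfold slopeQuarticTransform
  compute_degree

theorem eval_slopeQuarticTransform (s t : F) {A₀ A₁ A₂ m : F} (hm : A₀ * m - A₁ ≠ 0) :
    (slopeQuarticTransform s t A₀ A₁ A₂).eval m =
      (A₀ * m - A₁) ^ 4 * (slopeQuartic s t).eval ((A₁ * m - A₂) / (A₀ * m - A₁)) := by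
  simp only [slopeQuarticTransform, slopeQuartic, eval_sub, eval_mul, eval_pow, eval_C, eval_X]
  generalize A₀ * m - A₁ = d at hm
  field_simp

theorem slopeQuarticTransform_eq (s t A₀ A₁ A₂ : F) : slopeQuarticTransform s t A₀ A₁ A₂ =
    C (A₁ ^ 4 - 6 * s * A₁ ^ 2 * A₀ ^ 2 - 8 * t * A₁ * A₀ ^ 3 - 3 * s ^ 2 * A₀ ^ 4) * X ^ 4 +
    C (-4 * A₁ ^ 3 * A₂ + 12 * s * A₀ * A₁ * (A₁ ^ 2 + A₀ * A₂)
      + 8 * t * (3 * A₁ ^ 2 * A₀ ^ 2 + A₂ * A₀ ^ 3) + 12 * s ^ 2 * A₀ ^ 3 * A₁) * X ^ 3 +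
    C (6 * A₁ ^ 2 * A₂ ^ 2 - 6 * s * ((A₁ ^ 2 + A₀ * A₂) ^ 2 + 2 * A₀ * A₁ ^ 2 * A₂)
      - 8 * t * (3 * A₁ ^ 3 * A₀ + 3 * A₂ * A₀ ^ 2 * A₁) - 18 * s ^ 2 * A₀ ^ 2 * A₁ ^ 2) * X ^ 2 +
    C (-4 * A₁ * A₂ ^ 3 + 12 * s * A₁ * A₂ * (A₁ ^ 2 + A₀ * A₂)
      + 8 * t * (A₁ ^ 4 + 3 * A₂ * A₀ * A₁ ^ 2) + 12 * s ^ 2 * A₀ * A₁ ^ 3) * X +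
    C (A₂ ^ 4 - 6 * s * A₁ ^ 2 * A₂ ^ 2 - 8 * t * A₂ * A₁ ^ 3 - 3 * s ^ 2 * A₁ ^ 4) := by
  simp only [slopeQuarticTransform, map_add, map_mul, map_sub, map_pow, map_ofNat, map_neg]
  ring

theorem isSquare_of_coeff_eq (h2 : (2 : F) ≠ 0) (h3 : (3 : F) ≠ 0) {s t a c κ : F}
    (hb : t ^ 2 - s ^ 3 ≠ 0) (hδ : a ^ 2 - c ≠ 0)
    (c4 : a ^ 4 - 6 * s * a ^ 2 - 8 * t * a - 3 * s ^ 2 = κ)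
    (c3 : -4 * a ^ 3 * c + 12 * s * a * (a ^ 2 + c) + 8 * t * (3 * a ^ 2 + c)
      + 12 * s ^ 2 * a = 0)
    (c2 : 6 * a ^ 2 * c ^ 2 - 6 * s * ((a ^ 2 + c) ^ 2 + 2 * a ^ 2 * c)
      - 8 * t * (3 * a ^ 3 + 3 * c * a) - 18 * s ^ 2 * a ^ 2 = -6 * s * κ)
    (c1 : -4 * a * c ^ 3 + 12 * s * a * c * (a ^ 2 + c)
      + 8 * t * (a ^ 4 + 3 * c * a ^ 2) + 12 * s ^ 2 * a ^ 3 = -8 * t * κ)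
    (c0 : c ^ 4 - 6 * s * a ^ 2 * c ^ 2 - 8 * t * c * a ^ 3 - 3 * s ^ 2 * a ^ 4 =
      -3 * s ^ 2 * κ) :
    IsSquare κ ∧ κ ≠ 0 := by
  have hsq : ((a ^ 2 - c) ^ 2 - κ) * ((a ^ 2 - c) ^ 2 + κ) = 0 := by
    linear_combination (a ^ 4 + κ) * c4 + a ^ 3 * c3 + a ^ 2 * c2 + a * c1 + c0
  rcases mul_eq_zero.1 hsq with h | h
  · have hκ : κ = (a ^ 2 - c) * (a ^ 2 - c) := by linear_combination -h
    exact ⟨⟨_, hκ⟩, by rw [hκ]; exact mul_ne_zero hδ hδ⟩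
  exfalso
  have hκ : κ = -(a ^ 2 - c) ^ 2 := by linear_combination h
  subst hκ
  have h8 : (8 : F) ≠ 0 := by rw [show (8 : F) = 2 ^ 3 by norm_num]; exact pow_ne_zero _ h2
  have e1 : 2 * a ^ 3 - a * c - 3 * a * s - 2 * t = 0 := by
    have : 8 * (a ^ 2 - c) ^ 2 * (2 * a ^ 3 - a * c - 3 * a * s - 2 * t) = 0 := by
      linear_combination c1 + 2 * a * c2 + (4 * a ^ 2 - c) * c3 + (8 * a ^ 3 - 4 * a * c) * c4
    exact (mul_eq_zero.1 this).resolve_left (mul_ne_zero h8 (pow_ne_zero _ hδ))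
  have e2 : c ^ 2 - 4 * a ^ 2 * c + 6 * s * c - 3 * s ^ 2 = 0 := by
    have : 2 * (a ^ 2 - c) ^ 2 * (c ^ 2 - 4 * a ^ 2 * c + 6 * s * c - 3 * s ^ 2) = 0 := by
      linear_combination c0 - c * c2 - 2 * a * c * c3 - (4 * a ^ 2 * c - c ^ 2) * c4
    exact (mul_eq_zero.1 this).resolve_left (mul_ne_zero h2 (pow_ne_zero _ hδ))
  have e3 : 6 * ((a ^ 2 - s) * (a ^ 2 - c)) = 0 := by
    linear_combination -c4 + e2 + 4 * a * e1
  have h6 : (6 : F) ≠ 0 := by rw [show (6 : F) = 2 * 3 by norm_num]; exact mul_ne_zero h2 h3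
  have hs : a ^ 2 - s = 0 :=
    (mul_eq_zero.1 ((mul_eq_zero.1 e3).resolve_left h6)).resolve_right hδ
  have hs' : s = a ^ 2 := by linear_combination -hs
  subst hs'
  have e4 : (a ^ 2 - c) * (c + 3 * a ^ 2) = 0 := by linear_combination -e2
  have hc : c = -3 * a ^ 2 := by
    linear_combination (mul_eq_zero.1 e4).resolve_left hδ
  subst hc
  have h1 : 2 * (t - a ^ 3) = 0 := by linear_combination -e1
  have h4 : t = a ^ 3 := by linear_combination (mul_eq_zero.1 h1).resolve_left h2
  exact hb (by rw [h4]; ring)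

/-- If the transform of the quartic is proportional to it, the ratio is a nonzero square.
This uses that the curve has `j`-invariant zero. -/
theorem isSquare_of_slopeQuarticTransform_eq (h2 : (2 : F) ≠ 0) (h3 : (3 : F) ≠ 0) {s t : F}
    (hb : t ^ 2 - s ^ 3 ≠ 0) {A₀ A₁ A₂ : F} (hδ : A₀ * A₂ - A₁ ^ 2 ≠ 0) {κ : F}
    (h : slopeQuarticTransform s t A₀ A₁ A₂ = C κ * slopeQuartic s t) :
    IsSquare κ ∧ κ ≠ 0 := by
  have hF : C κ * slopeQuartic s t = C κ * X ^ 4 + C 0 * X ^ 3 + C (-6 * s * κ) * X ^ 2 +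
      C (-8 * t * κ) * X + C (-3 * s ^ 2 * κ) := by
    simp only [slopeQuartic, map_mul, map_pow, map_ofNat, map_neg, map_zero]
    ring
  rw [hF, slopeQuarticTransform_eq] at h
  have c4 := congrArg (fun f => coeff f 4) h
  have c3 := congrArg (fun f => coeff f 3) h
  have c2 := congrArg (fun f => coeff f 2) h
  have c1 := congrArg (fun f => coeff f 1) h
  have c0 := congrArg (fun f => coeff f 0) h
  simp only [coeff_add, coeff_C_mul, coeff_X_pow, coeff_X, coeff_C] at c4 c3 c2 c1 c0
  norm_num at c4 c3 c2 c1 c0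
  by_cases hA : A₀ = 0
  · subst hA
    have hκ : κ = A₁ ^ 2 * A₁ ^ 2 := by linear_combination -c4
    have hA1 : A₁ ≠ 0 := fun h => hδ (by simp [h])
    exact ⟨⟨_, hκ⟩, by rw [hκ]; exact mul_ne_zero (pow_ne_zero _ hA1) (pow_ne_zero _ hA1)⟩
  · obtain ⟨a, rfl⟩ : ∃ a, A₁ = a * A₀ := ⟨A₁ / A₀, by field_simp⟩
    obtain ⟨c, rfl⟩ : ∃ c, A₂ = c * A₀ := ⟨A₂ / A₀, by field_simp⟩
    obtain ⟨k, rfl⟩ : ∃ k, κ = k * A₀ ^ 4 := ⟨κ / A₀ ^ 4, by field_simp⟩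
    have hA4 : A₀ ^ 4 ≠ 0 := pow_ne_zero _ hA
    have hac : a ^ 2 - c ≠ 0 := fun h0 => hδ (by linear_combination -A₀ ^ 2 * h0)
    obtain ⟨⟨y, hy⟩, hk⟩ : IsSquare k ∧ k ≠ 0 := isSquare_of_coeff_eq h2 h3 hb hac
      (mul_left_cancel₀ hA4 (by linear_combination c4))
      (mul_left_cancel₀ hA4 (by linear_combination c3))
      (mul_left_cancel₀ hA4 (by linear_combination c2))
      (mul_left_cancel₀ hA4 (by linear_combination c1))
      (mul_left_cancel₀ hA4 (by linear_combination c0))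
    exact ⟨⟨y * A₀ ^ 2, by rw [hy]; ring⟩, mul_ne_zero hk hA4⟩

theorem slopeQuarticTransform_ne_zero (h2 : (2 : F) ≠ 0) (h3 : (3 : F) ≠ 0) {s t : F}
    (hb : t ^ 2 - s ^ 3 ≠ 0) {A₀ A₁ A₂ : F} (hδ : A₀ * A₂ - A₁ ^ 2 ≠ 0) :
    slopeQuarticTransform s t A₀ A₁ A₂ ≠ 0 := fun h =>
  (isSquare_of_slopeQuarticTransform_eq h2 h3 hb hδ (κ := 0) (by simpa using h)).2 rfl

theorem card_slopeQuarticTransform_le {g : ℕ} (hg : 2 * g + 1 = Fintype.card F) (s t : F)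
    {A₀ A₁ A₂ : F} (hδ : A₀ * A₂ - A₁ ^ 2 ≠ 0) :
    (Finset.univ.filter fun x : F => (slopeQuarticTransform s t A₀ A₁ A₂).eval x ^ g = -1).card ≤
      (Finset.univ.filter fun x : F => (slopeQuartic s t).eval x ^ g = -1).card := by
  have hfour : ∀ a : F, a ≠ 0 → (a ^ 4) ^ g = 1 := fun a ha => by
    rw [show (a ^ 4) ^ g = (a ^ (2 * g)) ^ 2 by ring, show 2 * g = Fintype.card F - 1 by omega,
      FiniteField.pow_card_sub_one_eq_one a ha, one_pow]
  have hneg : (1 : F) ≠ -1 := fun h => by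
    have h2 : ringChar F ≠ 2 := fun h => by
      have := FiniteField.even_card_of_char_two h
      omega
    exact Ring.neg_one_ne_one_of_char_ne_two h2 h.symm
  have hden : ∀ m : F, (slopeQuarticTransform s t A₀ A₁ A₂).eval m ^ g = -1 →
      A₀ * m - A₁ ≠ 0 := by
    intro m hm h0
    have h1 : (slopeQuarticTransform s t A₀ A₁ A₂).eval m = (A₁ * m - A₂) ^ 4 := by
      simp [slopeQuarticTransform, h0]
    have h2 : A₁ * m - A₂ ≠ 0 := fun h2 => hδ (by linear_combination A₁ * h0 - A₀ * h2)
    rw [h1, hfour _ h2] at hm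
    exact hneg hm
  refine Finset.card_le_card_of_injOn (fun m => (A₁ * m - A₂) / (A₀ * m - A₁)) ?_ ?_
  · intro m hm
    simp only [Finset.coe_filter, Finset.mem_univ, true_and, Set.mem_ofPred_eq] at hm ⊢
    have hd := hden m hm
    rwa [eval_slopeQuarticTransform s t hd, mul_pow, hfour _ hd, one_mul] at hm
  · intro m hm m' hm' h
    simp only [Finset.coe_filter, Finset.mem_univ, true_and, Set.mem_ofPred_eq] at hm hm' h
    rw [div_eq_div_iff (hden m hm) (hden m' hm')] at h
    have : (A₀ * A₂ - A₁ ^ 2) * (m - m') = 0 := by linear_combination h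
    exact sub_eq_zero.1 ((mul_eq_zero.1 this).resolve_left hδ)

theorem exists_isSquare_slopeQuartic {g : ℕ} (hg : 2 * g + 1 = Fintype.card F)
    (hq : 9887 < Fintype.card F) (h2 : (2 : F) ≠ 0) (h3 : (3 : F) ≠ 0) {s t : F} (ht : t ≠ 0)
    (hb : t ^ 2 - s ^ 3 ≠ 0) {A₀ A₁ A₂ : F} (hδ : A₀ * A₂ - A₁ ^ 2 ≠ 0) {E : F[X]}
    (hE0 : E ≠ 0) (hE : E.natDegree ≤ 20) :
    ∃ m, IsSquare ((slopeQuartic s t).eval m) ∧ (slopeQuartic s t).eval m ≠ 0 ∧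
      IsSquare ((slopeQuarticTransform s t A₀ A₁ A₂).eval m) ∧
      (slopeQuarticTransform s t A₀ A₁ A₂).eval m ≠ 0 ∧ E.eval m ≠ 0 := by
  have hQ0 := slopeQuartic_ne_zero s t
  have hT0 := slopeQuarticTransform_ne_zero h2 h3 hb hδ
  have hQ4 := slopeQuartic_natDegree s t
  have hT4 := slopeQuarticTransform_natDegree_le s t A₀ A₁ A₂
  have hQsq := slopeQuartic_ne_C_mul_sq h2 h3 ht hb
  by_cases hsq : ∃ (c : F) (H : F[X]),
      slopeQuartic s t * slopeQuarticTransform s t A₀ A₁ A₂ = C c * H ^ 2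
  · obtain ⟨c, H, hH⟩ := hsq
    have hc : c ≠ 0 := by
      rintro rfl
      exact mul_ne_zero hQ0 hT0 (by simpa using hH)
    have hdvd : slopeQuartic s t ∣ H := by
      refine ((slopeQuartic_squarefree h2 h3 ht hb).dvd_pow_iff_dvd two_ne_zero).1 ?_
      refine (IsUnit.dvd_mul_left (isUnit_C.2 (isUnit_iff_ne_zero.2 hc))).1 ?_
      exact ⟨_, hH.symm⟩
    obtain ⟨H', rfl⟩ := hdvd
    have hT : slopeQuarticTransform s t A₀ A₁ A₂ = slopeQuartic s t * (C c * H' ^ 2) :=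
      mul_left_cancel₀ hQ0 (by rw [hH]; ring)
    have hK0 : C c * H' ^ 2 ≠ 0 := fun h0 => hT0 (by rw [hT, h0, mul_zero])
    have hKd : (C c * H' ^ 2).natDegree = 0 := by
      have := congrArg natDegree hT
      rw [natDegree_mul hQ0 hK0] at this
      omega
    obtain ⟨κ, hκ⟩ := natDegree_eq_zero.1 hKd
    rw [← hκ, mul_comm] at hT
    obtain ⟨⟨y, hy⟩, hκ0⟩ := isSquare_of_slopeQuarticTransform_eq h2 h3 hb hδ hT
    obtain ⟨m, ⟨z, hz⟩, hm0, hmE⟩ := exists_isSquare_eval hg hq (by omega) hQsq hE0 hE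
    refine ⟨m, ⟨z, hz⟩, hm0, ?_, ?_, hmE⟩ <;> rw [hT, eval_mul, eval_C]
    · exact ⟨y * z, by rw [hz, hy]; ring⟩
    · exact mul_ne_zero hκ0 hm0
  · push Not at hsq
    have hNQ := card_pow_eq_neg_one_le hg hq (by omega) hQsq
    have hNT := card_slopeQuarticTransform_le hg s t hδ
    refine exists_isSquare_eval_pair hg hq hQ0 hT0 hE0 (by omega) hT4 hE hNQ (by omega) ?_
    refine card_pow_eq_neg_one_le hg hq ?_ hsq
    rw [natDegree_mul hQ0 hT0]
    omega

/-- The value at an affine point, or at the point at infinity `none`, of the function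
`β₀ + β₁ x + β₂ y + β₃ x² + β₄ x y`; its value at infinity is its leading coefficient `β₄`. -/
def evalAt (β : Fin 5 → F) : Option (F × F) → F
  | none => β 4
  | some (x, y) => β 0 + β 1 * x + β 2 * y + β 3 * x ^ 2 + β 4 * (x * y)

/-- The linear form with coefficients `l` vanishes on some nonzero function
`β₀ + β₁ x + β₂ y + β₃ x² + β₄ x y` having five distinct zeros on `y² = x³ + b`. -/
def HasFiveZeros (b : F) (l : Fin 5 → F) : Prop :=
  ∃ β : Fin 5 → F, β ≠ 0 ∧ ∑ i, β i * l i = 0 ∧ ∃ v : List (Option (F × F)), v.Nodup ∧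
    v.length = 5 ∧ ∀ P ∈ v, evalAt β P = 0 ∧ ∀ x y, P = some (x, y) → y ^ 2 = x ^ 3 + b

theorem exists_points_of_slope (h2 : (2 : F) ≠ 0) {s t m : F}
    (hsq : IsSquare ((slopeQuartic s t).eval m)) (h0 : (slopeQuartic s t).eval m ≠ 0)
    (hs : 3 * s ^ 2 + 2 * t * m ≠ 0) :
    ∃ x₁ x₂ : F, x₁ ≠ x₂ ∧ x₁ ≠ s ∧ x₂ ≠ s ∧
      x₁ ^ 2 + x₁ * s + s ^ 2 = m ^ 2 * (x₁ - s) - 2 * t * m ∧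
      x₂ ^ 2 + x₂ * s + s ^ 2 = m ^ 2 * (x₂ - s) - 2 * t * m := by
  obtain ⟨w, hw⟩ := hsq
  have hw0 : w ≠ 0 := by
    rintro rfl
    exact h0 (by simpa using hw)
  simp only [slopeQuartic, eval_sub, eval_mul, eval_pow, eval_C, eval_X] at hw
  have hne : ∀ x : F, x ^ 2 + x * s + s ^ 2 = m ^ 2 * (x - s) - 2 * t * m → x ≠ s := by
    rintro x hx rfl
    exact hs (by linear_combination hx)
  have h4 : (4 : F) ≠ 0 := by rw [show (4 : F) = 2 * 2 by norm_num]; exact mul_ne_zero h2 h2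
  have hx : ∀ x : F, (2 * x - (m ^ 2 - s)) ^ 2 = w * w →
      x ^ 2 + x * s + s ^ 2 = m ^ 2 * (x - s) - 2 * t * m := fun x hx =>
    mul_left_cancel₀ h4 (by linear_combination hx - hw)
  have hx1 := hx ((m ^ 2 - s + w) / 2) (by field_simp; ring)
  have hx2 := hx ((m ^ 2 - s - w) / 2) (by field_simp; ring)
  refine ⟨_, _, ?_, hne _ hx1, hne _ hx2, hx1, hx2⟩
  intro h
  rw [div_left_inj' h2] at h
  have : 2 * w = 0 := by linear_combination h
  exact (mul_ne_zero h2 hw0) this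

theorem quadratic_ne_zero {a b c : F} (h : ¬(a = 0 ∧ b = 0 ∧ c = 0)) :
    C a * X ^ 2 + C b * X + C c ≠ (0 : F[X]) := by
  intro h0
  have h1 := congrArg (fun f => coeff f 2) h0
  have h2 := congrArg (fun f => coeff f 1) h0
  have h3 := congrArg (fun f => coeff f 0) h0
  simp only [coeff_add, coeff_C_mul, coeff_X_pow, coeff_X, coeff_C, coeff_zero] at h1 h2 h3
  norm_num at h1 h2 h3
  exact h ⟨h1, h2, h3⟩

theorem hasFiveZeros_of_point {g : ℕ} (hg : 2 * g + 1 = Fintype.card F)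
    (hq : 9887 < Fintype.card F) (h2 : (2 : F) ≠ 0) (h3 : (3 : F) ≠ 0) {b s t k : F} (hb : b ≠ 0)
    (ht : t ≠ 0) (hst : t ^ 2 = s ^ 3 + b) (hk : 2 * t * k = 3 * s ^ 2) {l : Fin 5 → F}
    {A₀ A₁ A₂ : F}
    (hA₀ : A₀ = l 2 - t * l 0 - k * (l 1 - s * l 0))
    (hA₁ : A₁ = l 3 + s * l 1 + s ^ 2 * l 0 - k * l 2 - k * t * l 0)
    (hA₂ : A₂ = l 4 + 2 * s * l 2 + t * l 1 + 2 * s * t * l 0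
      - k * (l 3 + s * l 1 + s ^ 2 * l 0))
    (hδ : A₀ * A₂ - A₁ ^ 2 ≠ 0) : HasFiveZeros b l := by
  obtain ⟨xR, hxR⟩ : ∃ xR, xR = k ^ 2 - 2 * s := ⟨_, rfl⟩
  obtain ⟨yR, hyR⟩ : ∃ yR, yR = t + k * (xR - s) := ⟨_, rfl⟩
  obtain ⟨u, hu⟩ : ∃ u, u = (yR + t) / (xR - s) := ⟨_, rfl⟩
  have hb' : t ^ 2 - s ^ 3 ≠ 0 := by rw [hst]; simpa using hb
  have hlin : ∀ κ : F, C 0 * X ^ 2 + C (A₁ + κ * A₀) * X + C (-(A₂ + κ * A₁)) ≠ (0 : F[X]) :=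
    fun κ => quadratic_ne_zero fun ⟨_, h4, h5⟩ =>
      hδ (by linear_combination -A₀ * h5 - A₁ * h4)
  have hE0 : (C 0 * X ^ 2 + C A₀ * X + C (-A₁)) * (C A₀ * X ^ 2 + C (-2 * A₁) * X + C A₂) *
      (C 0 * X ^ 2 + C 1 * X + C k) * (C 0 * X ^ 2 + C 1 * X + C (-u)) *
      (C 0 * X ^ 2 + C (A₁ + k * A₀) * X + C (-(A₂ + k * A₁))) *
      (C 0 * X ^ 2 + C (A₁ + (-u) * A₀) * X + C (-(A₂ + (-u) * A₁))) ≠ (0 : F[X]) := by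
    refine mul_ne_zero (mul_ne_zero (mul_ne_zero (mul_ne_zero (mul_ne_zero ?_ ?_) ?_) ?_)
      (hlin _)) (hlin _) <;> refine quadratic_ne_zero ?_
    · rintro ⟨-, h4, h5⟩
      exact hδ (by linear_combination A₂ * h4 + A₁ * h5)
    · rintro ⟨h4, h5, h6⟩
      have : A₁ = 0 := by simpa [h2] using h5
      exact hδ (by rw [h4, this]; ring)
    · simp
    · simp
  obtain ⟨m, hm1, hm2, hm3, hm4, hmE⟩ :=
    exists_isSquare_slopeQuartic hg hq h2 h3 ht hb' hδ hE0 (by compute_degree; norm_num)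
  simp only [eval_mul, eval_add, eval_C, eval_X, eval_pow, mul_ne_zero_iff] at hmE
  obtain ⟨⟨⟨⟨⟨hd, hfix⟩, hmk⟩, hmu⟩, hmk'⟩, hmu'⟩ := hmE
  replace hd : A₀ * m - A₁ ≠ 0 := fun h => hd (by linear_combination h)
  obtain ⟨m', hm'⟩ : ∃ m', m' = (A₁ * m - A₂) / (A₀ * m - A₁) := ⟨_, rfl⟩
  have hmm' : m' * (A₀ * m - A₁) = A₁ * m - A₂ := by rw [hm', div_mul_cancel₀ _ hd]
  rw [eval_slopeQuarticTransform s t hd, ← hm'] at hm3 hm4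
  have hm5 : (slopeQuartic s t).eval m' ≠ 0 := (mul_ne_zero_iff.1 hm4).2
  have hm6 : IsSquare ((slopeQuartic s t).eval m') := by
    obtain ⟨z, hz⟩ := hm3
    refine ⟨z / (A₀ * m - A₁) ^ 2, ?_⟩
    generalize A₀ * m - A₁ = d at *
    field_simp
    linear_combination hz
  have hne : m ≠ m' := fun h => hfix (by rw [← h] at hmm'; linear_combination hmm')
  have hmk2 : m' + k ≠ 0 := fun h => hmk' (by
    linear_combination (A₀ * m - A₁) * h - hmm')
  have hmu1 : m ≠ u := fun h => hmu (by linear_combination h)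
  have hmu2 : m' ≠ u := fun h => hmu' (by
    linear_combination (A₀ * m - A₁) * h - hmm')
  have htk : ∀ m : F, m + k ≠ 0 → 3 * s ^ 2 + 2 * t * m ≠ 0 := fun m hm h => by
    refine mul_ne_zero (mul_ne_zero h2 ht) hm ?_
    linear_combination h + hk
  obtain ⟨x₁, x₂, h12, h1s, h2s, hx₁, hx₂⟩ :=
    exists_points_of_slope h2 hm1 hm2 (htk m fun h => hmk (by linear_combination h))
  obtain ⟨x₃, x₄, h34, h3s, h4s, hx₃, hx₄⟩ := exists_points_of_slope h2 hm6 hm5 (htk m' hmk2)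
  have hR : ∀ m x : F, m ≠ u → x ≠ s → x = xR → -t + m * (x - s) = yR → False := by
    rintro m x hm hx rfl h
    refine hm ?_
    rw [hu, ← h, eq_div_iff (sub_ne_zero.2 hx)]
    ring
  have hcross : ∀ x x' : F, x ≠ s → x = x' → -t + m * (x - s) = -t + m' * (x' - s) → False := by
    rintro x x' hx rfl h
    have : (m - m') * (x - s) = 0 := by linear_combination h
    exact mul_ne_zero (sub_ne_zero.2 hne) (sub_ne_zero.2 hx) this
  have hcurve : ∀ m x : F, x ^ 2 + x * s + s ^ 2 = m ^ 2 * (x - s) - 2 * t * m →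
      (-t + m * (x - s)) ^ 2 = x ^ 3 + b := fun m x hx => by
    linear_combination hst - (x - s) * hx
  refine ⟨![2 * s * t - k * s ^ 2 - (m + m') * (s ^ 2 - k * t) + m * m' * (-t + k * s),
      t - k * s - (m + m') * s - m * m' * k, 2 * s + (m + m') * k + m * m',
      -k - (m + m'), 1], ?_, ?_,
    [some (x₁, -t + m * (x₁ - s)), some (x₂, -t + m * (x₂ - s)),
      some (x₃, -t + m' * (x₃ - s)), some (x₄, -t + m' * (x₄ - s)), some (xR, yR)], ?_, rfl, ?_⟩
  · intro h
    have := congrFun h 4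
    simp at this
  · simp [Fin.sum_univ_five]
    rw [hA₀, hA₁, hA₂] at hmm'
    linear_combination hmm'
  · simp only [List.nodup_cons, List.mem_cons, List.not_mem_nil, or_false, Option.some.injEq,
      Prod.mk.injEq, not_or, not_and, List.nodup_nil, not_false_eq_true, and_true]
    exact ⟨⟨fun h => absurd h h12, fun h h' => hcross _ _ h1s h h', fun h h' => hcross _ _ h1s h h',
      fun h h' => hR _ _ hmu1 h1s h h'⟩, ⟨fun h h' => hcross _ _ h2s h h',
      fun h h' => hcross _ _ h2s h h', fun h h' => hR _ _ hmu1 h2s h h'⟩,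
      ⟨fun h => absurd h h34, fun h h' => hR _ _ hmu2 h3s h h'⟩,
      fun h h' => hR _ _ hmu2 h4s h h'⟩
  · simp only [List.mem_cons, List.not_mem_nil, or_false]
    rintro P (rfl | rfl | rfl | rfl | rfl) <;>
      simp only [evalAt, Option.some.injEq, Prod.mk.injEq, and_imp, Matrix.cons_val]
    · exact ⟨by linear_combination -(k + m') * hx₁ + m * hk,
        by rintro _ _ rfl rfl; exact hcurve _ _ hx₁⟩
    · exact ⟨by linear_combination -(k + m') * hx₂ + m * hk,
        by rintro _ _ rfl rfl; exact hcurve _ _ hx₂⟩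
    · exact ⟨by linear_combination -(k + m) * hx₃ + m' * hk,
        by rintro _ _ rfl rfl; exact hcurve _ _ hx₃⟩
    · exact ⟨by linear_combination -(k + m) * hx₄ + m' * hk,
        by rintro _ _ rfl rfl; exact hcurve _ _ hx₄⟩
    · refine ⟨?_, ?_⟩
      · rw [hyR, hxR]
        linear_combination (m + m' + k) * hk
      · rintro _ _ rfl rfl
        rw [hyR, hxR]
        linear_combination hst + (k ^ 2 - 3 * s) * hk

theorem exists_point {g : ℕ} (hg : 2 * g + 1 = Fintype.card F)
    (hq : 9887 < Fintype.card F) (b : F) {E : F[X]} (hE0 : E ≠ 0) (hE : E.natDegree ≤ 20) :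
    ∃ s t : F, t ≠ 0 ∧ t ^ 2 = s ^ 3 + b ∧ E.eval s ≠ 0 := by
  have hdeg : (X ^ 3 + C b : F[X]).natDegree = 3 := natDegree_X_pow_add_C
  obtain ⟨s, ⟨t, ht⟩, h0, hs⟩ := exists_isSquare_eval hg hq (G := X ^ 3 + C b) (by omega)
    (fun c H h => by
      have h1 := congrArg natDegree h
      rw [hdeg] at h1
      by_cases hc : c = 0
      · simp [hc] at h1
      · rw [natDegree_C_mul hc, natDegree_pow] at h1
        omega) hE0 hE
  refine ⟨s, t, ?_, ?_, hs⟩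
  · rintro rfl
    exact h0 (by simpa using ht)
  · simp only [eval_add, eval_pow, eval_X, eval_C] at ht
    linear_combination -ht

theorem hasFiveZeros_of_polynomial {g : ℕ} (hg : 2 * g + 1 = Fintype.card F)
    (hq : 9887 < Fintype.card F) (h2 : (2 : F) ≠ 0) (h3 : (3 : F) ≠ 0) {b : F} (hb : b ≠ 0)
    {l : Fin 5 → F} {P Q : F[X]}
    (hP : P = C (l 0 * l 3 - l 1 ^ 2) * (X ^ 5 + C (10 * b) * X ^ 2)
      - C (l 2 ^ 2 - l 1 * l 3 - b * l 0 ^ 2) * (X ^ 4 - C (8 * b) * X)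
      + C (l 2 * l 4 - l 3 ^ 2 - b * l 0 * l 1) * (C 4 * X ^ 3 + C (4 * b)))
    (hQ : Q = C (l 0 * l 4 - l 1 * l 2) * (C 2 * X ^ 3 - C (4 * b))
      - C (l 1 * l 4 - l 2 * l 3) * (C 6 * X ^ 2))
    {E : F[X]} (hE0 : E ≠ 0) (hE : E.natDegree ≤ 20)
    (hPQ : ∀ s, E.eval s ≠ 0 → P.eval s ≠ 0 ∨ Q.eval s ≠ 0) : HasFiveZeros b l := by
  obtain ⟨s, t, ht, hst, hs⟩ := exists_point hg hq b hE0 hE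
  obtain ⟨τ, hτ, hτs, hτPQ⟩ : ∃ τ : F, τ ≠ 0 ∧ τ ^ 2 = s ^ 3 + b ∧
      P.eval s + τ * Q.eval s ≠ 0 := by
    by_contra! hc
    have h4 := hc t ht hst
    have h5 := hc (-t) (neg_ne_zero.2 ht) (by rw [neg_sq, hst])
    have h6 : P.eval s = 0 := mul_left_cancel₀ h2 (by linear_combination h4 + h5)
    have h7 : Q.eval s = 0 :=
      mul_left_cancel₀ (mul_ne_zero h2 ht) (by linear_combination h4 - h5)
    exact (hPQ s hs).elim (· h6) (· h7)
  have h2τ : 2 * τ ≠ 0 := mul_ne_zero h2 hτ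
  have hk : 2 * τ * (3 * s ^ 2 / (2 * τ)) = 3 * s ^ 2 := mul_div_cancel₀ _ h2τ
  generalize 3 * s ^ 2 / (2 * τ) = k at hk
  refine hasFiveZeros_of_point hg hq h2 h3 hb hτ hτs hk rfl rfl rfl fun h => hτPQ ?_
  have hbe : b = τ ^ 2 - s ^ 3 := by linear_combination -hτs
  rw [hP, hQ]
  simp only [eval_add, eval_sub, eval_mul, eval_pow, eval_X, eval_C]
  have hA₀ : 2 * τ * (l 2 - τ * l 0 - k * (l 1 - s * l 0)) =
      2 * τ * (l 2 - τ * l 0) - 3 * s ^ 2 * (l 1 - s * l 0) := by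
    linear_combination -(l 1 - s * l 0) * hk
  have hA₁ : 2 * τ * (l 3 + s * l 1 + s ^ 2 * l 0 - k * l 2 - k * τ * l 0) =
      2 * τ * (l 3 + s * l 1 + s ^ 2 * l 0) - 3 * s ^ 2 * (l 2 + τ * l 0) := by
    linear_combination -(l 2 + τ * l 0) * hk
  have hA₂ : 2 * τ * (l 4 + 2 * s * l 2 + τ * l 1 + 2 * s * τ * l 0
      - k * (l 3 + s * l 1 + s ^ 2 * l 0)) =
      2 * τ * (l 4 + 2 * s * l 2 + τ * l 1 + 2 * s * τ * l 0)
      - 3 * s ^ 2 * (l 3 + s * l 1 + s ^ 2 * l 0) := by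
    linear_combination -(l 3 + s * l 1 + s ^ 2 * l 0) * hk
  generalize l 2 - τ * l 0 - k * (l 1 - s * l 0) = A₀ at *
  generalize l 3 + s * l 1 + s ^ 2 * l 0 - k * l 2 - k * τ * l 0 = A₁ at *
  generalize l 4 + 2 * s * l 2 + τ * l 1 + 2 * s * τ * l 0
      - k * (l 3 + s * l 1 + s ^ 2 * l 0) = A₂ at *
  have h4 : (2 * τ * A₀) * (2 * τ * A₂) - (2 * τ * A₁) ^ 2 = 0 := by
    linear_combination (2 * τ) ^ 2 * h
  rw [hA₀, hA₁, hA₂] at h4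
  rw [← h4, hbe]
  ring

theorem exists_primitive_cube_root (h1 : Fintype.card F % 3 = 1) :
    ∃ ω : F, ω ≠ 1 ∧ ω ^ 2 ≠ 1 ∧ ω ^ 3 = 1 := by
  have : Fact (Nat.Prime 3) := ⟨Nat.prime_three⟩
  have hpos : 0 < Fintype.card F := Fintype.card_pos
  obtain ⟨u, hu⟩ := exists_prime_orderOf_dvd_card (G := Fˣ) 3 (by
    rw [Fintype.card_units]; omega)
  refine ⟨u, fun h => ?_, fun h => ?_, ?_⟩
  · have h4 : u = 1 := Units.ext h
    simp [h4] at hu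
  · have h4 : u ^ 2 = 1 := Units.ext (by simpa using h)
    have := orderOf_dvd_of_pow_eq_one h4
    rw [hu] at this
    omega
  · have h4 : u ^ 3 = 1 := hu ▸ pow_orderOf_eq_one u
    simpa using congrArg Units.val h4

theorem ne_neg_self_of_ne_zero (h2 : (2 : F) ≠ 0) {y : F} (hy : y ≠ 0) : y ≠ -y := fun h =>
  mul_ne_zero h2 hy (by linear_combination h)

theorem hasFiveZeros_of_vertical_lines (h2 : (2 : F) ≠ 0) {b x₁ y₁ x₂ y₂ : F} {l : Fin 5 → F}
    (hx : x₁ ≠ x₂) (hy₁ : y₁ ≠ 0) (hy₂ : y₂ ≠ 0) (h₁ : y₁ ^ 2 = x₁ ^ 3 + b)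
    (h₂ : y₂ ^ 2 = x₂ ^ 3 + b) (hl : x₁ * x₂ * l 0 - (x₁ + x₂) * l 1 + l 3 = 0) :
    HasFiveZeros b l := by
  refine ⟨![x₁ * x₂, -(x₁ + x₂), 0, 1, 0], ?_, ?_,
    [none, some (x₁, y₁), some (x₁, -y₁), some (x₂, y₂), some (x₂, -y₂)], ?_, rfl, ?_⟩
  · intro h
    have := congrFun h 3
    simp at this
  · simp only [Fin.sum_univ_five, Matrix.cons_val]
    linear_combination hl
  · simp [hx, ne_neg_self_of_ne_zero h2 hy₁, ne_neg_self_of_ne_zero h2 hy₂]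
  · simp only [List.mem_cons, List.not_mem_nil, or_false]
    rintro P (rfl | rfl | rfl | rfl | rfl) <;>
      simp only [evalAt, Option.some.injEq, Prod.mk.injEq, and_imp, Matrix.cons_val]
    · simp
    · exact ⟨by ring, by rintro _ _ rfl rfl; exact h₁⟩
    · exact ⟨by ring, by rintro _ _ rfl rfl; rw [neg_sq]; exact h₁⟩
    · exact ⟨by ring, by rintro _ _ rfl rfl; exact h₂⟩
    · exact ⟨by ring, by rintro _ _ rfl rfl; rw [neg_sq]; exact h₂⟩

theorem hasFiveZeros_of_two_torsion (h2 : (2 : F) ≠ 0) (h1 : Fintype.card F % 3 = 1)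
    {b x₀ x₁ y₁ : F} (hb : b ≠ 0) {l : Fin 5 → F} (hy₁ : y₁ ≠ 0) (h₁ : y₁ ^ 2 = x₁ ^ 3 + b)
    (h₀ : x₀ ^ 3 + b = 0) (hl2 : l 2 = 0) (hl4 : l 4 = 0) : HasFiveZeros b l := by
  obtain ⟨ω, hω1, hω2, hω3⟩ := exists_primitive_cube_root h1
  have hx₀ : x₀ ≠ 0 := by
    rintro rfl
    exact hb (by linear_combination h₀)
  have hω0 : ω ≠ 0 := by
    rintro rfl
    simp at hω3
  refine ⟨![0, 0, -x₁, 0, 1], ?_, ?_,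
    [some (x₀, 0), some (ω * x₀, 0), some (ω ^ 2 * x₀, 0), some (x₁, y₁), some (x₁, -y₁)],
    ?_, rfl, ?_⟩
  · intro h
    have := congrFun h 4
    simp at this
  · simp [Fin.sum_univ_five, hl2, hl4]
  · have e1 : x₀ ≠ ω * x₀ := fun h => hω1 (mul_right_cancel₀ hx₀ (by linear_combination -h))
    have e2 : x₀ ≠ ω ^ 2 * x₀ := fun h => hω2 (mul_right_cancel₀ hx₀ (by linear_combination -h))
    have e3 : ω * x₀ ≠ ω ^ 2 * x₀ := fun h =>
      hω1 (mul_left_cancel₀ (mul_ne_zero hω0 hx₀) (by linear_combination -h))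
    simp only [List.nodup_cons, List.mem_cons, List.not_mem_nil, or_false, Option.some.injEq,
      Prod.mk.injEq, not_or, not_and, List.nodup_nil, not_false_eq_true, and_true]
    exact ⟨⟨fun h => absurd h e1, fun h => absurd h e2, fun _ => hy₁.symm,
      fun _ => (neg_ne_zero.2 hy₁).symm⟩, ⟨fun h => absurd h e3, fun _ => hy₁.symm,
      fun _ => (neg_ne_zero.2 hy₁).symm⟩, ⟨fun _ => hy₁.symm, fun _ => (neg_ne_zero.2 hy₁).symm⟩,
      fun _ => ne_neg_self_of_ne_zero h2 hy₁⟩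
  · simp only [List.mem_cons, List.not_mem_nil, or_false]
    rintro P (rfl | rfl | rfl | rfl | rfl) <;>
      simp only [evalAt, Option.some.injEq, Prod.mk.injEq, and_imp, Matrix.cons_val]
    · exact ⟨by ring, by rintro _ _ rfl rfl; linear_combination -h₀⟩
    · exact ⟨by ring, by rintro _ _ rfl rfl; linear_combination -h₀ - x₀ ^ 3 * hω3⟩
    · exact ⟨by ring, by
        rintro _ _ rfl rfl; linear_combination -h₀ - x₀ ^ 3 * (ω ^ 3 + 1) * hω3⟩
    · exact ⟨by ring, by rintro _ _ rfl rfl; exact h₁⟩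
    · exact ⟨by ring, by rintro _ _ rfl rfl; rw [neg_sq]; exact h₁⟩

theorem hasFiveZeros {g : ℕ} (hg : 2 * g + 1 = Fintype.card F)
    (hq : 9887 < Fintype.card F) (h1 : Fintype.card F % 3 = 1) (h2 : (2 : F) ≠ 0)
    (h3 : (3 : F) ≠ 0) {b : F} (hb : b ≠ 0) (l : Fin 5 → F) : HasFiveZeros b l := by
  obtain ⟨P, hP⟩ : ∃ P : F[X], P = C (l 0 * l 3 - l 1 ^ 2) * (X ^ 5 + C (10 * b) * X ^ 2)
      - C (l 2 ^ 2 - l 1 * l 3 - b * l 0 ^ 2) * (X ^ 4 - C (8 * b) * X)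
      + C (l 2 * l 4 - l 3 ^ 2 - b * l 0 * l 1) * (C 4 * X ^ 3 + C (4 * b)) := ⟨_, rfl⟩
  obtain ⟨Q, hQ⟩ : ∃ Q : F[X], Q = C (l 0 * l 4 - l 1 * l 2) * (C 2 * X ^ 3 - C (4 * b))
      - C (l 1 * l 4 - l 2 * l 3) * (C 6 * X ^ 2) := ⟨_, rfl⟩
  by_cases hP0 : P ≠ 0
  · exact hasFiveZeros_of_polynomial hg hq h2 h3 hb hP hQ hP0
      (by rw [hP]; compute_degree; norm_num) fun s hs => Or.inl hs
  by_cases hQ0 : Q ≠ 0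
  · exact hasFiveZeros_of_polynomial hg hq h2 h3 hb hP hQ hQ0
      (by rw [hQ]; compute_degree; norm_num) fun s hs => Or.inr hs
  push Not at hP0 hQ0
  rw [hP] at hP0
  rw [hQ] at hQ0
  have h4 : (4 : F) ≠ 0 := by rw [show (4 : F) = 2 * 2 by norm_num]; exact mul_ne_zero h2 h2
  have q1 := congrArg (fun f => coeff f 5) hP0
  have q4 := congrArg (fun f => coeff f 4) hP0
  have q5 := congrArg (fun f => coeff f 3) hP0
  have q2 := congrArg (fun f => coeff f 3) hQ0
  simp only [coeff_add, coeff_sub, coeff_C_mul, coeff_X_pow, coeff_X, coeff_C,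
    coeff_zero] at q1 q4 q5 q2
  norm_num [h2, h4] at q1 q4 q5 q2
  by_cases hl0 : l 0 = 0
  · simp only [hl0, zero_mul, zero_sub, mul_zero, neg_eq_zero, sub_eq_zero, ne_eq,
      OfNat.ofNat_ne_zero, not_false_eq_true, pow_eq_zero_iff, zero_pow] at q1 q4 q5
    have hl2 : l 2 = 0 := by simpa [q1] using q4
    have hl3 : l 3 = 0 := by simpa [hl2] using q5.symm
    obtain ⟨x₁, y₁, hy₁, h₁, -⟩ := exists_point hg hq b (E := 1) one_ne_zero (by simp)
    obtain ⟨x₂, y₂, hy₂, h₂, hx⟩ := exists_point hg hq b (X_sub_C_ne_zero x₁) (by simp)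
    refine hasFiveZeros_of_vertical_lines h2 (b := b) (x₁ := x₁) (x₂ := x₂) ?_ hy₁ hy₂ h₁ h₂ ?_
    · rintro rfl
      simp at hx
    · rw [hl0, q1, hl3]
      ring
  · obtain ⟨x₀, hx₀⟩ : ∃ x₀, l 1 = x₀ * l 0 := ⟨l 1 / l 0, by field_simp⟩
    obtain ⟨y₀, hy₀⟩ : ∃ y₀, l 2 = y₀ * l 0 := ⟨l 2 / l 0, by field_simp⟩
    have hl3 : l 3 = x₀ ^ 2 * l 0 :=
      mul_left_cancel₀ hl0 (by rw [hx₀] at q1; linear_combination q1)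
    have hl4 : l 4 = x₀ * y₀ * l 0 :=
      mul_left_cancel₀ hl0 (by rw [hx₀, hy₀] at q2; linear_combination q2)
    have h₀ : y₀ ^ 2 = x₀ ^ 3 + b :=
      mul_left_cancel₀ (pow_ne_zero 2 hl0) (by
        rw [hy₀, hx₀, hl3] at q4; linear_combination -q4)
    obtain ⟨x₁, y₁, hy₁, h₁, hx⟩ := exists_point hg hq b (X_sub_C_ne_zero x₀) (by simp)
    by_cases hy : y₀ = 0
    · refine hasFiveZeros_of_two_torsion h2 h1 hb (x₀ := x₀) hy₁ h₁ ?_ ?_ ?_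
      · rw [← h₀, hy]; ring
      · rw [hy₀, hy]; ring
      · rw [hl4, hy]; ring
    · refine hasFiveZeros_of_vertical_lines h2 (b := b) (x₁ := x₀) (x₂ := x₁) ?_ hy hy₁ h₀ h₁ ?_
      · rintro rfl
        simp at hx
      · rw [hl3, hx₀]
        ring

/-- The norm of `β₀ + β₁ x + β₂ y + β₃ x² + β₄ x y` to the field of rational functions in `x`. -/
noncomputable def normPoly (b : F) (β : Fin 5 → F) : F[X] :=
  (X ^ 3 + C b) * (C (β 2) + C (β 4) * X) ^ 2 -
    (C (β 0) + C (β 1) * X + C (β 3) * X ^ 2) ^ 2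

theorem normPoly_eq (b : F) (β : Fin 5 → F) : normPoly b β =
    C (β 4 ^ 2) * X ^ 5 + C (2 * β 2 * β 4 - β 3 ^ 2) * X ^ 4 +
    C (β 2 ^ 2 - 2 * β 1 * β 3) * X ^ 3 + C (b * β 4 ^ 2 - β 1 ^ 2 - 2 * β 0 * β 3) * X ^ 2 +
    C (2 * b * β 2 * β 4 - 2 * β 0 * β 1) * X + C (b * β 2 ^ 2 - β 0 ^ 2) := by
  simp only [normPoly, map_sub, map_mul, map_pow, map_ofNat]
  ring

theorem normPoly_ne_zero (b : F) {β : Fin 5 → F} (hβ : β ≠ 0) : normPoly b β ≠ 0 := by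
  intro h
  rw [normPoly_eq] at h
  have c5 := congrArg (fun f => coeff f 5) h
  have c4 := congrArg (fun f => coeff f 4) h
  have c3 := congrArg (fun f => coeff f 3) h
  have c2 := congrArg (fun f => coeff f 2) h
  have c0 := congrArg (fun f => coeff f 0) h
  simp only [coeff_add, coeff_C_mul, coeff_X_pow, coeff_X, coeff_C, coeff_zero] at c5 c4 c3 c2 c0
  norm_num at c5 c4 c3 c2 c0
  simp only [c5, mul_zero, zero_sub, neg_eq_zero, ne_eq, OfNat.ofNat_ne_zero,
    not_false_eq_true, pow_eq_zero_iff] at c4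
  simp only [c4, mul_zero, sub_zero, ne_eq, OfNat.ofNat_ne_zero,
    not_false_eq_true, pow_eq_zero_iff] at c3
  have h1 : β 1 = 0 := by simpa [c5, c4] using c2
  have h0 : β 0 = 0 := by simpa [c3] using c0
  refine hβ (funext fun i => ?_)
  fin_cases i <;> simp [c5, c4, c3, h1, h0]

theorem card_fiber_le_count {b : F} {β : Fin 5 → F} (hβ : β ≠ 0) {T : Finset (F × F)}
    (hT : ∀ P ∈ T, evalAt β (some P) = 0 ∧ P.2 ^ 2 = P.1 ^ 3 + b) (x : F) :
    (T.filter fun P => P.1 = x).card ≤ (normPoly b β).roots.count x := by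
  have hN := normPoly_ne_zero b hβ
  rw [count_roots]
  by_cases hD : β 2 + β 4 * x = 0
  · rcases (T.filter fun P => P.1 = x).eq_empty_or_nonempty with h | ⟨⟨x', y⟩, hP⟩
    · simp [h]
    rw [Finset.mem_filter] at hP
    obtain ⟨hP, rfl : x' = x⟩ := hP
    have h0 := (hT _ hP).1
    simp only [evalAt] at h0
    have hN0 : β 0 + β 1 * x' + β 3 * x' ^ 2 = 0 := by linear_combination h0 - y * hD
    have hle : 2 ≤ (normPoly b β).rootMultiplicity x' := by
      rw [le_rootMultiplicity_iff hN]
      refine dvd_sub ((pow_dvd_pow_of_dvd ?_ 2).mul_left _) (pow_dvd_pow_of_dvd ?_ 2) <;>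
        rw [dvd_iff_isRoot] <;> simp [hD, hN0]
    refine le_trans ?_ hle
    have hY : (X ^ 2 - C (x' ^ 3 + b) : F[X]) ≠ 0 := X_pow_sub_C_ne_zero two_pos _
    refine le_trans ?_ ((card_eval_eq_zero_le hY).trans_eq natDegree_X_pow_sub_C)
    refine Finset.card_le_card_of_injOn Prod.snd ?_ ?_
    · rintro ⟨x, y⟩ h
      simp only [Finset.coe_filter, Set.mem_ofPred_eq] at h
      obtain ⟨h, rfl⟩ := h
      have := (hT _ h).2
      simp at this ⊢
      rw [this, sub_self]
    · rintro ⟨x, y⟩ h ⟨x', y'⟩ h' hy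
      simp only [Finset.coe_filter, Set.mem_ofPred_eq] at h h' hy
      rw [h.2, h'.2, hy]
  · rcases (T.filter fun P => P.1 = x).eq_empty_or_nonempty with h | ⟨⟨x', y⟩, hP⟩
    · simp [h]
    rw [Finset.mem_filter] at hP
    obtain ⟨hP, rfl : x' = x⟩ := hP
    refine le_trans (Finset.card_le_one.2 ?_) ((rootMultiplicity_pos hN).2 ?_)
    · rintro ⟨x, y⟩ h ⟨x', y'⟩ h'
      rw [Finset.mem_filter] at h h'
      obtain ⟨h, rfl⟩ := h
      obtain ⟨h', h''⟩ := h'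
      simp only at h''
      subst h''
      have h0 := (hT _ h).1
      have h0' := (hT _ h').1
      simp only [evalAt] at h0 h0'
      rw [mul_left_cancel₀ hD (show (β 2 + β 4 * x') * y = (β 2 + β 4 * x') * y' by
        linear_combination h0 - h0')]
    · have h0 := (hT _ hP).1
      have h1 := (hT _ hP).2
      simp only [evalAt] at h0 h1
      simp only [IsRoot.def, normPoly, eval_sub, eval_mul, eval_add, eval_pow, eval_X, eval_C]
      linear_combination -(β 2 + β 4 * x') ^ 2 * h1 +
        ((β 2 + β 4 * x') * y - (β 0 + β 1 * x' + β 3 * x' ^ 2)) * h0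

theorem card_affine_zeros_le {b : F} {β : Fin 5 → F} (hβ : β ≠ 0) {T : Finset (F × F)}
    (hT : ∀ P ∈ T, evalAt β (some P) = 0 ∧ P.2 ^ 2 = P.1 ^ 3 + b) :
    T.card ≤ (normPoly b β).natDegree := by
  refine le_trans ?_ (card_roots' _)
  rw [← Multiset.toFinset_sum_count_eq, Finset.card_eq_sum_card_fiberwise (f := Prod.fst)
    (t := (normPoly b β).roots.toFinset)]
  · exact Finset.sum_le_sum fun x _ => card_fiber_le_count hβ hT x
  · intro P hP
    rw [Finset.mem_coe, Multiset.mem_toFinset, ← Multiset.count_pos]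
    refine lt_of_lt_of_le ?_ (card_fiber_le_count hβ hT P.1)
    exact Finset.card_pos.2 ⟨P, Finset.mem_filter.2 ⟨hP, rfl⟩⟩

/-- A nonzero function `β₀ + β₁ x + β₂ y + β₃ x² + β₄ x y` has at most five zeros on
`y² = x³ + b`, counting the point at infinity. -/
theorem card_zeros_le {b : F} {β : Fin 5 → F} (hβ : β ≠ 0) {T : Finset (Option (F × F))}
    (hT : ∀ P ∈ T, evalAt β P = 0 ∧ ∀ x y, P = some (x, y) → y ^ 2 = x ^ 3 + b) :
    T.card ≤ 5 := by
  have haff := card_affine_zeros_le hβ (b := b) (T := T.eraseNone) fun P hP => by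
    rw [Finset.mem_eraseNone] at hP
    exact ⟨(hT _ hP).1, (hT _ hP).2 _ _ rfl⟩
  by_cases hnone : none ∈ T
  · have h4 : β 4 = 0 := (hT _ hnone).1
    have hdeg : (normPoly b β).natDegree ≤ 4 := by
      rw [normPoly_eq, h4]
      simp only [ne_eq, OfNat.ofNat_ne_zero, not_false_eq_true, zero_pow, map_zero, zero_mul,
        zero_add]
      compute_degree
    have := Finset.card_eraseNone_of_mem hnone
    omega
  · have hdeg : (normPoly b β).natDegree ≤ 5 := by
      rw [normPoly_eq]
      compute_degree
    have := Finset.card_eraseNone_of_not_mem hnone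
    omega

theorem evalAt_eq_sum (β : Fin 5 → F) (P : Option (F × F)) :
    evalAt β P = ∑ i, β i * evalAt (Pi.single i 1) P := by
  rcases P with _ | ⟨x, y⟩ <;> simp [evalAt, Fin.sum_univ_five, Pi.single_apply]

theorem hammingNorm_add_card_zeros {n : ℕ} (x : Fin n → F) :
    hammingNorm x + (Finset.univ.filter fun j => x j = 0).card = n := by
  have := Finset.card_filter_add_card_filter_not (s := Finset.univ) fun j => x j = 0
  rw [Finset.card_univ, Fintype.card_fin, add_comm] at this
  exact this

theorem not_isHExtendable_three {g : ℕ} (hg : 2 * g + 1 = Fintype.card F)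
    (hq : 9887 < Fintype.card F) (h1 : Fintype.card F % 3 = 1) (h2 : (2 : F) ≠ 0)
    (h3 : (3 : F) ≠ 0) {b : F} (hb : b ≠ 0) {n : ℕ} {θ : Fin n → Option (F × F)}
    (hθ : Function.Injective θ) (hcurve : ∀ j x y, θ j = some (x, y) → y ^ 2 = x ^ 3 + b)
    (hinf : ∃ j, θ j = none) (hsurj : ∀ x y : F, y ^ 2 = x ^ 3 + b → ∃ j, θ j = some (x, y))
    {C : Submodule F (Fin n → F)} (hC : ∀ c, c ∈ C ↔ ∃ β, c = fun j => evalAt β (θ j)) :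
    ¬ IsHExtendable 3 C := by
  rintro ⟨C', -, hd, hmap⟩
  have hzeros : ∀ β : Fin 5 → F, β ≠ 0 →
      (Finset.univ.filter fun j => evalAt β (θ j) = 0).card ≤ 5 := fun β hβ => by
    rw [← Finset.card_image_of_injective _ hθ]
    refine card_zeros_le (b := b) hβ fun P hP => ?_
    obtain ⟨j, hj, rfl⟩ := Finset.mem_image.1 hP
    exact ⟨(Finset.mem_filter.1 hj).2, hcurve j⟩
  have hn : 5 < n := by
    by_contra! hn
    obtain ⟨s, t, -, hst, hs⟩ := exists_point hg hq b
      (E := ∏ j : Fin n, (X - Polynomial.C (((θ j).getD 0).1)))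
      (Finset.prod_ne_zero_iff.2 fun j _ => X_sub_C_ne_zero _) (by
        rw [natDegree_prod _ _ fun j _ => X_sub_C_ne_zero _]
        simp
        omega)
    obtain ⟨j, hj⟩ := hsurj s t hst
    refine hs ?_
    rw [eval_prod]
    exact Finset.prod_eq_zero (Finset.mem_univ j) (by simp [hj])
  have hlift : ∀ i : Fin 5, ∃ r ∈ C', LinearMap.funLeft F F (Fin.castAdd 3) r =
      fun j => evalAt (Pi.single i 1) (θ j) := fun i => by
    rw [← Submodule.mem_map, hmap, hC]
    exact ⟨_, rfl⟩
  choose r hrC hr using hlift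
  obtain ⟨β, hβ, hl, v, hv, hv5, hvP⟩ :=
    hasFiveZeros hg hq h1 h2 h3 hb fun i => r i (Fin.natAdd n 0)
  obtain ⟨w, hw⟩ : ∃ w, w = ∑ i, β i • r i := ⟨_, rfl⟩
  have hwC : w ∈ C' := by
    rw [hw]
    exact C'.sum_mem fun i _ => C'.smul_mem _ (hrC i)
  have hw0 : w (Fin.natAdd n 0) = 0 := by
    rw [hw, ← hl]
    simp
  have hwj : ∀ j, w (Fin.castAdd 3 j) = evalAt β (θ j) := fun j => by
    rw [hw, evalAt_eq_sum]
    simp only [Finset.sum_apply, Pi.smul_apply, smul_eq_mul]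
    exact Finset.sum_congr rfl fun i _ => congrArg _ (congrFun (hr i) j)
  have hfive : 5 ≤ (Finset.univ.filter fun j => evalAt β (θ j) = 0).card := by
    rw [← Finset.card_image_of_injective _ hθ, ← hv5, ← List.toFinset_card_of_nodup hv]
    refine Finset.card_le_card fun P hP => ?_
    obtain ⟨h0, hPc⟩ := hvP P (List.mem_toFinset.1 hP)
    obtain ⟨j, rfl⟩ : ∃ j, θ j = P := by
      rcases P with _ | ⟨x, y⟩
      · exact hinf
      · exact hsurj x y (hPc x y rfl)
    exact Finset.mem_image_of_mem _ (Finset.mem_filter.2 ⟨Finset.mem_univ _, h0⟩)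
  have hcw0 : (fun j => evalAt β (θ j)) ≠ 0 := fun h => by
    have := hzeros β hβ
    rw [Finset.filter_true_of_mem (p := fun j => evalAt β (θ j) = 0) fun j _ => congrFun h j,
      Finset.card_univ, Fintype.card_fin] at this
    omega
  have hwne : w ≠ 0 := fun h => hcw0 (funext fun j => by rw [← hwj, h]; rfl)
  have hwnorm : hammingNorm w ≤ hammingNorm (fun j => evalAt β (θ j)) + 2 := by
    simp only [hammingNorm, Finset.card_filter]
    rw [Fin.sum_univ_add, Fin.sum_univ_three]
    simp only [hwj, hw0, ne_eq, not_true_eq_false, if_false, zero_add]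
    refine Nat.add_le_add_left ?_ _
    split_ifs <;> omega
  have hd' : minDist C' ≤ hammingNorm w := Nat.sInf_le ⟨w, hwC, hwne, rfl⟩
  obtain ⟨x, hxC, hx0, hx⟩ : minDist C ∈ {d | ∃ x ∈ C, x ≠ 0 ∧ hammingNorm x = d} :=
    Nat.sInf_mem ⟨_, _, (hC _).2 ⟨β, rfl⟩, hcw0, rfl⟩
  obtain ⟨β', rfl⟩ := (hC x).1 hxC
  have hβ' : β' ≠ 0 := by
    rintro rfl
    exact hx0 (funext fun j => by rw [evalAt_eq_sum]; simp)
  have e1 := hammingNorm_add_card_zeros fun j => evalAt β (θ j)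
  have e2 := hammingNorm_add_card_zeros fun j => evalAt β' (θ j)
  have e3 := hzeros β' hβ'
  omega

/-- The coordinates `(x + r, y + μ x + ν)` of a point of a Weierstrass curve. -/
def shiftPoint (W : WeierstrassCurve F) (r μ ν : F) : W.toAffine.Point → Option (F × F)
  | .zero => none
  | .some x y _ => some (x + r, y + μ * x + ν)

theorem shiftPoint_injective (W : WeierstrassCurve F) (r μ ν : F) :
    Function.Injective (shiftPoint W r μ ν) := by
  rintro (_ | ⟨x, y, h⟩) (_ | ⟨x', y', h'⟩) he
  · rfl
  · simp [shiftPoint] at he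
  · simp [shiftPoint] at he
  · simp only [shiftPoint, Option.some.injEq, Prod.mk.injEq, add_left_inj] at he
    obtain ⟨rfl, he⟩ := he
    obtain rfl : y = y' := by linear_combination he
    rfl

/-- The coefficients in the coordinates `(x, y)` of the function with coefficients `β` in the
coordinates `(x + r, y + μ x + ν)`. -/
def shiftCoeff (r μ ν : F) (β : Fin 5 → F) : Fin 5 → F :=
  ![β 0 + β 1 * r + β 2 * ν + β 3 * r ^ 2 + β 4 * r * ν,
    β 1 + β 2 * μ + 2 * r * β 3 + β 4 * (ν + r * μ), β 2 + β 4 * r, β 3 + β 4 * μ, β 4]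

theorem evalAt_shiftPoint (W : WeierstrassCurve F) (r μ ν : F) (β : Fin 5 → F)
    (P : W.toAffine.Point) :
    evalAt β (shiftPoint W r μ ν P) = ∑ i, shiftCoeff r μ ν β i * phiVec W 5 P i := by
  rcases P with _ | ⟨x, y, h⟩
  · simp [shiftPoint, shiftCoeff, evalAt, phiVec, Fin.sum_univ_five]
  · simp [shiftPoint, shiftCoeff, evalAt, phiVec, psi, Fin.sum_univ_five]
    ring

theorem shiftCoeff_surjective (r μ ν : F) : Function.Surjective (shiftCoeff r μ ν) := by
  intro α
  obtain ⟨β₂, h₂⟩ : ∃ β₂, α 2 = β₂ + α 4 * r := ⟨α 2 - α 4 * r, by ring⟩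
  obtain ⟨β₃, h₃⟩ : ∃ β₃, α 3 = β₃ + α 4 * μ := ⟨α 3 - α 4 * μ, by ring⟩
  obtain ⟨β₁, h₁⟩ : ∃ β₁, α 1 = β₁ + β₂ * μ + 2 * r * β₃ + α 4 * (ν + r * μ) :=
    ⟨α 1 - (β₂ * μ + 2 * r * β₃ + α 4 * (ν + r * μ)), by ring⟩
  refine ⟨![α 0 - (β₁ * r + β₂ * ν + β₃ * r ^ 2 + α 4 * r * ν), β₁, β₂, β₃, α 4],
    funext fun i => ?_⟩
  fin_cases i <;> simp [shiftCoeff, h₁, h₂, h₃]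
  ring

theorem mem_ellipticCode_iff (W : WeierstrassCurve F) (r μ ν : F) {n : ℕ}
    (e : Fin n ≃ W.toAffine.Point) (c : Fin n → F) :
    c ∈ ellipticCode W 5 e ↔ ∃ β, c = fun j => evalAt β (shiftPoint W r μ ν (e j)) := by
  rw [ellipticCode, Submodule.mem_span_range_iff_exists_fun, (shiftCoeff_surjective r μ ν).exists]
  refine exists_congr fun β => ?_
  rw [eq_comm, funext_iff, funext_iff]
  simp [evalAt_shiftPoint]

theorem exists_shift_equation (W : WeierstrassCurve F) [W.IsElliptic] (hj : W.j = 0)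
    (h2 : (2 : F) ≠ 0) (h3 : (3 : F) ≠ 0) : ∃ r μ ν b : F, b ≠ 0 ∧
      ∀ x y, W.toAffine.Nonsingular x y ↔ (y + μ * x + ν) ^ 2 = (x + r) ^ 3 + b := by
  have hc4 : W.c₄ = 0 := by simpa [W.j_eq_zero_iff'] using hj
  have h864 : (864 : F) ≠ 0 := by
    rw [show (864 : F) = 2 ^ 5 * 3 ^ 3 by norm_num]
    exact mul_ne_zero (pow_ne_zero _ h2) (pow_ne_zero _ h3)
  have h1728 : (1728 : F) ≠ 0 := by
    rw [show (1728 : F) = 2 * 864 by norm_num]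
    exact mul_ne_zero h2 h864
  have hc6 : W.c₆ ≠ 0 := fun h => by
    have := W.c_relation
    rw [hc4, h] at this
    refine mul_ne_zero h1728 (W.isUnit_Δ.ne_zero) ?_
    rw [this]
    ring
  obtain ⟨r, hr⟩ : ∃ r, W.b₂ = 12 * r := by
    refine ⟨W.b₂ / 12, ?_⟩
    have : (12 : F) ≠ 0 := by
      rw [show (12 : F) = 2 * 2 * 3 by norm_num]
      exact mul_ne_zero (mul_ne_zero h2 h2) h3
    field_simp
  obtain ⟨μ, hμ⟩ : ∃ μ, W.a₁ = 2 * μ := ⟨W.a₁ / 2, by field_simp⟩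
  obtain ⟨ν, hν⟩ : ∃ ν, W.a₃ = 2 * ν := ⟨W.a₃ / 2, by field_simp⟩
  obtain ⟨b, hb⟩ : ∃ b, W.c₆ = -864 * b := ⟨-W.c₆ / 864, by field_simp⟩
  refine ⟨r, μ, ν, b, fun h => hc6 (by rw [hb, h, mul_zero]), fun x y => ?_⟩
  have h4 : (4 : F) ≠ 0 := by rw [show (4 : F) = 2 * 2 by norm_num]; exact mul_ne_zero h2 h2
  have h24 : (24 : F) ≠ 0 := by
    rw [show (24 : F) = 4 * 2 * 3 by norm_num]
    exact mul_ne_zero (mul_ne_zero h4 h2) h3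
  have h216 : (216 : F) ≠ 0 := by
    rw [show (216 : F) = 24 * 3 * 3 by norm_num]
    exact mul_ne_zero (mul_ne_zero h24 h3) h3
  have hb4 : W.b₄ = 6 * r ^ 2 := mul_left_cancel₀ h24 (by
    rw [WeierstrassCurve.c₄, hr] at hc4
    linear_combination -hc4)
  have hb6 : W.b₆ = 4 * (r ^ 3 + b) := mul_left_cancel₀ h216 (by
    rw [WeierstrassCurve.c₆, hr, hb4] at hb
    linear_combination -hb)
  rw [WeierstrassCurve.b₂, hμ] at hr
  rw [WeierstrassCurve.b₄, hμ, hν] at hb4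
  rw [WeierstrassCurve.b₆, hν] at hb6
  have ha2 : W.a₂ = 3 * r - μ ^ 2 := mul_left_cancel₀ h4 (by linear_combination hr)
  have ha4 : W.a₄ = 3 * r ^ 2 - 2 * μ * ν := mul_left_cancel₀ h2 (by linear_combination hb4)
  have ha6 : W.a₆ = r ^ 3 + b - ν ^ 2 := mul_left_cancel₀ h4 (by linear_combination hb6)
  rw [← Affine.equation_iff_nonsingular, Affine.equation_iff', hμ, hν, ha2, ha4, ha6]
  constructor <;> intro h <;> linear_combination h

end

/-- Let `q = p^r`, `p > 3` prime, `q > 9887`, and `E/F_q` elliptic with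
`j(E) = 0` and an even number of rational points. If `r` is even or `p ≡ 1 (mod 3)`, then
the `5`-elliptic code associated to `E` is not `3`-extendable. -/
theorem statement17 (p r : ℕ) (hp : p.Prime) (hp3 : 3 < p)
    (hcard : Fintype.card F = p ^ r) (hq : 9887 < Fintype.card F)
    (W : WeierstrassCurve F) [W.IsElliptic] (hj : W.j = 0)
    (heven : Even (Nat.card W.toAffine.Point))
    (hcase : Even r ∨ p % 3 = 1) {n : ℕ}
    (hn : n = Nat.card W.toAffine.Point) (e : Fin n ≃ W.toAffine.Point) :
    ¬ IsHExtendable 3 (ellipticCode W 5 e) := by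
  have : Fact p.Prime := ⟨hp⟩
  have hr0 : r ≠ 0 := by
    rintro rfl
    rw [hcard, pow_zero] at hq
    omega
  have hchar : CharP F p := by
    obtain ⟨p', hp'⟩ := CharP.exists F
    obtain ⟨k, hp'', hk⟩ := FiniteField.card F p'
    have hdvd : p ∣ p' ^ (k : ℕ) := by
      rw [← hk, hcard]
      exact dvd_pow_self p hr0
    rwa [(Nat.prime_dvd_prime_iff_eq hp hp'').1 (hp.dvd_of_dvd_pow hdvd)]
  have hcast : ∀ m : ℕ, 0 < m → m < p → (m : F) ≠ 0 := fun m hm hmp h =>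
    absurd (Nat.le_of_dvd hm ((CharP.cast_eq_zero_iff F p m).1 h)) (by omega)
  have h2 : (2 : F) ≠ 0 := by exact_mod_cast hcast 2 (by norm_num) (by omega)
  have h3 : (3 : F) ≠ 0 := by exact_mod_cast hcast 3 (by norm_num) (by omega)
  have hodd : Odd (Fintype.card F) := by
    rw [hcard]
    exact (hp.odd_of_ne_two (by omega)).pow
  obtain ⟨g, hg⟩ := hodd
  have h1 : Fintype.card F % 3 = 1 := by
    rw [hcard]
    have hp0 : p % 3 ≠ 0 := fun h => by
      have := (Nat.prime_dvd_prime_iff_eq Nat.prime_three hp).1 (Nat.dvd_of_mod_eq_zero h)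
      omega
    have hp12 : p % 3 = 1 ∨ p % 3 = 2 := by omega
    rcases hcase with ⟨k, hk⟩ | h
    · rw [hk, ← two_mul, pow_mul, Nat.pow_mod, Nat.pow_mod p 2]
      rcases hp12 with h | h <;> simp [h]
    · rw [Nat.pow_mod, h]
      simp
  obtain ⟨ρ, μ, ν, b, hb, hW⟩ := exists_shift_equation W hj h2 h3
  refine not_isHExtendable_three hg.symm hq h1 h2 h3 hb
    ((shiftPoint_injective W ρ μ ν).comp e.injective) ?_ ?_ ?_ (mem_ellipticCode_iff W ρ μ ν e)
  · intro j x y hxy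
    simp only [Function.comp_apply] at hxy
    generalize e j = P at hxy
    rcases P with _ | ⟨x', y', h⟩
    · simp [shiftPoint] at hxy
    · simp only [shiftPoint, Option.some.injEq, Prod.mk.injEq] at hxy
      rw [← hxy.1, ← hxy.2]
      exact (hW x' y').1 h
  · exact ⟨e.symm .zero, by simp [shiftPoint]⟩
  · intro x y hxy
    have h : W.toAffine.Nonsingular (x - ρ) (y - μ * (x - ρ) - ν) := by
      rw [hW]
      linear_combination hxy
    refine ⟨e.symm (.some _ _ h), ?_⟩
    simp only [Function.comp_apply, Equiv.apply_symm_apply, shiftPoint, Option.some.injEq,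
      Prod.mk.injEq]
    constructor <;> ring

end NMDS
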